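/- Suppose m = m(n) with m, n → ∞ and m/C(n,2) → p ∈ (0,1]. Let p_c be the unique root in [0,1] of the equation 3·e^{−2p(1−p)/(2−p)²} = 4 − 2p (numerically p_c ≈ 0.799288221). For each n fix three distinct vertices s, a, b of ⃗G(n,m). If 0 < p < p_c, then Cov({s↛a}, {b↛s}) < 0 for all sufficiently large n; if p_c < p ≤ 1, then Cov({s↛a}, {b↛s}) > 0 for all sufficiently large n. -/

import Mathlib

open Filter Real

/-- Edges of the complete graph on `Fin n`: ordered pairs `(u,v)` with `u < v`. -/
abbrev Edge (n : ℕ) : Type := {e : Fin n × Fin n // e.1 < e.2}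

/-- A configuration of the random edge-orientation model: for each pair `u < v`,
`none` means no edge, `some true` means the directed edge `u → v`, and
`some false` means the directed edge `v → u`. -/
abbrev Config (n : ℕ) : Type := Edge n → Option Bool

/-- The directed edge relation determined by a configuration. -/
def DirEdge {n : ℕ} (f : Config n) (u v : Fin n) : Prop :=
  (∃ h : u < v, f ⟨(u, v), h⟩ = some true) ∨ (∃ h : v < u, f ⟨(v, u), h⟩ = some false)

/-- `Reaches f u v`: the configuration `f` contains a directed path from `u` to `v`
(paths of length `0` are allowed, so `Reaches f u u` always holds). -/
def Reaches {n : ℕ} (f : Config n) (u v : Fin n) : Prop :=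
  Relation.ReflTransGen (DirEdge f) u v

/-- The probability of an event under a weight function on a finite sample space. -/
noncomputable def prWeight {α : Type*} [Fintype α] (w : α → ℝ) (E : Set α) : ℝ :=
  ∑ x, E.indicator w x

/-- The weight of one edge state in `⃗G(n,p)`: no edge has probability `1 - p`
and each of the two orientations has probability `p/2`. -/
noncomputable def edgeWeight (p : ℝ) : Option Bool → ℝ
  | none => 1 - p
  | some _ => p / 2

/-- The probability of an event in the random directed graph `⃗G(n,p)`. -/
noncomputable def PrGnp (n : ℕ) (p : ℝ) (E : Set (Config n)) : ℝ :=
  prWeight (fun f => ∏ e : Edge n, edgeWeight p (f e)) E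

/-- The number of present edges of a configuration. -/
def edgeCount {n : ℕ} (f : Config n) : ℕ :=
  (Finset.univ.filter fun e : Edge n => (f e).isSome).card

/-- The probability of an event in the random directed graph `⃗G(n,m)`:
the underlying graph is uniform among the graphs with exactly `m` edges, and each
present edge is oriented in one of its two directions with probability `1/2`,
independently over edges. -/
noncomputable def PrGnm (n m : ℕ) (E : Set (Config n)) : ℝ :=
  prWeight (fun f => if edgeCount f = m
      then ((Nat.choose (Nat.choose n 2) m : ℝ) * 2 ^ m)⁻¹ else 0) E

section EdgeSets

open Finset

lemma card_edge (n : ℕ) : Fintype.card (Edge n) = n.choose 2 := by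
  rw [Fintype.card_subtype, ← Finset.card_map ⟨Prod.swap, Prod.swap_injective⟩]
  have : (Finset.map ⟨Prod.swap, Prod.swap_injective⟩
      (univ.filter fun e : Fin n × Fin n => e.1 < e.2)) =
      (univ : Finset (Fin n)).biUnion fun v => ({v} : Finset (Fin n)) ×ˢ Finset.Iio v := by
    ext ⟨u, v⟩
    simp
  rw [this, Finset.card_biUnion]
  · simp only [card_product, card_singleton, Fin.card_Iio, one_mul]
    rw [Fin.sum_univ_eq_sum_range (fun i => i), Finset.sum_range_id, Nat.choose_two_right]
  · intro u _ v _ huv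
    simp only [Function.onFun, Finset.disjoint_left, mem_product, mem_singleton]
    rintro ⟨x, y⟩ ⟨h1, -⟩ ⟨h2, -⟩
    exact huv (h1 ▸ h2)

/-- The configuration `f` has none of the directed edges in `D`. -/
def Avoids {n : ℕ} (D : Finset (Fin n × Fin n)) (f : Config n) : Prop :=
  ∀ d ∈ D, ¬ DirEdge f d.1 d.2

/-- `D` contains each unordered pair of distinct vertices in at most one direction. -/
def IsOriented {n : ℕ} (D : Finset (Fin n × Fin n)) : Prop :=
  ∀ u v, (u, v) ∈ D → u ≠ v ∧ (v, u) ∉ D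

/-- The states of the edge `e` that avoid the directed edges in `D`. -/
def allowed {n : ℕ} (D : Finset (Fin n × Fin n)) (e : Edge n) : Finset (Option Bool) :=
  univ.filter fun o => (o = some true → (e.1.1, e.1.2) ∉ D) ∧ (o = some false → (e.1.2, e.1.1) ∉ D)

/-- The edges underlying `D`. -/
def support {n : ℕ} (D : Finset (Fin n × Fin n)) : Finset (Edge n) :=
  univ.filter fun e => (e.1.1, e.1.2) ∈ D ∨ (e.1.2, e.1.1) ∈ D

lemma avoids_iff {n : ℕ} (D : Finset (Fin n × Fin n)) (f : Config n) :
    Avoids D f ↔ f ∈ Fintype.piFinset (allowed D) := by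
  simp only [Avoids, DirEdge, Fintype.mem_piFinset, allowed, mem_filter, mem_univ, true_and]
  constructor
  · rintro h ⟨⟨u, v⟩, huv⟩
    exact ⟨fun h1 h2 => h _ h2 (Or.inl ⟨huv, h1⟩), fun h1 h2 => h _ h2 (Or.inr ⟨huv, h1⟩)⟩
  · rintro h ⟨u, v⟩ hd (⟨huv, h1⟩ | ⟨huv, h1⟩)
    · exact (h ⟨(u, v), huv⟩).1 h1 hd
    · exact (h ⟨(v, u), huv⟩).2 h1 hd

lemma card_support {n : ℕ} {D : Finset (Fin n × Fin n)} (hD : IsOriented D) :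
    (support D).card = D.card := by
  have h1 : (univ.filter fun e : Edge n => (e.1.1, e.1.2) ∈ D).card =
      (D.filter fun d => d.1 < d.2).card := by
    refine Finset.card_bij (fun e _ => e.1) ?_ ?_ ?_
    · rintro ⟨⟨u, v⟩, h⟩ hd
      simpa [h] using hd
    · rintro e _ e' _ h
      exact Subtype.ext h
    · rintro ⟨u, v⟩ hd
      rw [mem_filter] at hd
      exact ⟨⟨(u, v), hd.2⟩, by simpa using hd.1, rfl⟩
  have h2 : (univ.filter fun e : Edge n => (e.1.2, e.1.1) ∈ D).card =
      (D.filter fun d => ¬ d.1 < d.2).card := by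
    refine Finset.card_bij (fun e _ => (e.1.2, e.1.1)) ?_ ?_ ?_
    · rintro ⟨⟨u, v⟩, h⟩ hd
      simpa [h.le] using hd
    · rintro ⟨⟨u, v⟩, h⟩ _ ⟨⟨u', v'⟩, h'⟩ _ h
      simp_all
    · rintro ⟨u, v⟩ hd
      rw [mem_filter] at hd
      have := (hD u v hd.1).1
      exact ⟨⟨(v, u), lt_of_le_of_ne (not_lt.1 hd.2) this.symm⟩, by simpa using hd.1, rfl⟩
  rw [support, Finset.filter_or, Finset.card_union_of_disjoint, h1, h2,
    Finset.card_filter_add_card_filter_not]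
  rw [Finset.disjoint_left]
  intro e h h'
  simp only [mem_filter, mem_univ, true_and] at h h'
  exact (hD _ _ h).2 h'

lemma prod_sum_allowed {R : Type*} [CommSemiring R] {n : ℕ} (w : Option Bool → R)
    (A : Edge n → Finset (Option Bool)) (K : Finset (Edge n)) (α β : R)
    (hK : ∀ e ∈ K, ∑ o ∈ A e, w o = α) (hK' : ∀ e ∉ K, ∑ o ∈ A e, w o = β) :
    ∑ f ∈ Fintype.piFinset A, ∏ e, w (f e) = α ^ K.card * β ^ (n.choose 2 - K.card) := by
  rw [← Finset.prod_univ_sum A (fun _ o => w o), ← Finset.prod_mul_prod_compl K,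
    Finset.prod_congr rfl hK, Finset.prod_const,
    Finset.prod_congr rfl (fun e he => hK' e (Finset.mem_compl.1 he)), Finset.prod_const,
    Finset.card_compl, card_edge]

lemma sum_avoids {R : Type*} [CommSemiring R] {n : ℕ} (w : Option Bool → R) (y : R)
    (hw : ∀ b, w (some b) = y) {D : Finset (Fin n × Fin n)} (hD : IsOriented D) :
    ∑ f ∈ Fintype.piFinset (allowed D), ∏ e, w (f e) =
      (w none + y) ^ D.card * (w none + 2 * y) ^ (n.choose 2 - D.card) := by
  rw [← card_support hD]
  apply prod_sum_allowed
  · rintro ⟨⟨u, v⟩, h⟩ he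
    simp only [support, mem_filter, mem_univ, true_and] at he
    rw [allowed, Finset.sum_filter, Fintype.sum_option, Fintype.sum_bool]
    rcases he with he | he <;> simp [he, (hD _ _ he).2, hw]
  · rintro ⟨⟨u, v⟩, h⟩ he
    simp only [support, mem_filter, mem_univ, true_and, not_or] at he
    rw [allowed, Finset.sum_filter, Fintype.sum_option, Fintype.sum_bool]
    simp [he, hw, two_mul]

lemma sum_avoids_both {R : Type*} [CommSemiring R] {n : ℕ} (w : Option Bool → R) (y : R)
    (hw : ∀ b, w (some b) = y) {D : Finset (Fin n × Fin n)} (hD : IsOriented D) :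
    ∑ f ∈ Fintype.piFinset (allowed (D ∪ D.map (Equiv.prodComm _ _).toEmbedding)),
        ∏ e, w (f e) =
      w none ^ D.card * (w none + 2 * y) ^ (n.choose 2 - D.card) := by
  rw [← card_support hD]
  apply prod_sum_allowed
  · rintro ⟨⟨u, v⟩, h⟩ he
    simp only [support, mem_filter, mem_univ, true_and] at he
    rw [allowed, Finset.sum_filter, Fintype.sum_option, Fintype.sum_bool]
    rcases he with he | he <;> simp [he]
  · rintro ⟨⟨u, v⟩, h⟩ he
    simp only [support, mem_filter, mem_univ, true_and, not_or] at he
    rw [allowed, Finset.sum_filter, Fintype.sum_option, Fintype.sum_bool]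
    simp [he, hw, two_mul]

end EdgeSets

section Probability

open Finset

lemma prWeight_eq_sum {α : Type*} [Fintype α] (w : α → ℝ) (s : Finset α) {P : α → Prop}
    (h : ∀ x, P x ↔ x ∈ s) : prWeight w {x | P x} = ∑ x ∈ s, w x := by
  classical
  rw [prWeight, ← Finset.sum_subset (Finset.subset_univ s)]
  · exact Finset.sum_congr rfl fun x hx => Set.indicator_of_mem ((h x).2 hx) w
  · exact fun x _ hx => Set.indicator_of_notMem (fun h' => hx ((h x).1 h')) w

lemma PrGnp_avoids {n : ℕ} (p : ℝ) {D : Finset (Fin n × Fin n)} (hD : IsOriented D) :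
    PrGnp n p {f | Avoids D f} = (1 - p / 2) ^ D.card := by
  rw [PrGnp, prWeight_eq_sum _ (Fintype.piFinset (allowed D)) (avoids_iff D),
    sum_avoids (edgeWeight p) (p / 2) (fun _ => rfl) hD]
  have h1 : edgeWeight p none + 2 * (p / 2) = 1 := by simp only [edgeWeight]; ring
  have h2 : edgeWeight p none + p / 2 = 1 - p / 2 := by simp only [edgeWeight]; ring
  rw [h1, h2, one_pow, mul_one]

lemma PrGnp_avoids_both {n : ℕ} (p : ℝ) {D : Finset (Fin n × Fin n)} (hD : IsOriented D) :
    PrGnp n p {f | Avoids (D ∪ D.map (Equiv.prodComm _ _).toEmbedding) f} =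
      (1 - p) ^ D.card := by
  rw [PrGnp, prWeight_eq_sum _ (Fintype.piFinset (allowed _)) (avoids_iff _),
    sum_avoids_both (edgeWeight p) (p / 2) (fun _ => rfl) hD]
  have h1 : edgeWeight p none + 2 * (p / 2) = 1 := by simp only [edgeWeight]; ring
  rw [h1, one_pow, mul_one, edgeWeight]

open Polynomial in
/-- The number of configurations with `m` edges on `a + k` pairs, when one of the two
orientations is forbidden on `k` of the pairs. -/
noncomputable def oriCount (a k m : ℕ) : ℝ :=
  ((1 + 2 * X) ^ a * (1 + X) ^ k : ℝ[X]).coeff m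

open Polynomial in
lemma oriCount_zero_right (a m : ℕ) : oriCount a 0 m = (a.choose m : ℝ) * 2 ^ m := by
  have : ((1 + 2 * X) ^ a * (1 + X) ^ 0 : ℝ[X]) = ((1 + X) ^ a : ℝ[X]).comp (C 2 * X) := by
    simp [show (2 : ℝ[X]) = C 2 from rfl]
  rw [oriCount, this, Polynomial.comp_C_mul_X_coeff, Polynomial.coeff_one_add_X_pow]

open Polynomial in
lemma card_avoids {n : ℕ} (m : ℕ) {D : Finset (Fin n × Fin n)} (hD : IsOriented D) :
    (((Fintype.piFinset (allowed D)).filter fun f => edgeCount f = m).card : ℝ) =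
      oriCount (n.choose 2 - D.card) D.card m := by
  have := sum_avoids (fun o : Option Bool => if o.isSome then (X : ℝ[X]) else 1) X
    (fun _ => by simp) hD
  simp only [Option.isSome_none, Bool.false_eq_true, if_false] at this
  rw [oriCount, mul_comm, ← this, Polynomial.finsetSum_coeff, Finset.card_filter, Nat.cast_sum]
  refine Finset.sum_congr rfl fun f _ => ?_
  rw [Finset.prod_ite, Finset.prod_const, Finset.prod_const_one, mul_one,
    Polynomial.coeff_X_pow]
  change ((if edgeCount f = m then 1 else 0 : ℕ) : ℝ) = if m = edgeCount f then 1 else 0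
  simp only [eq_comm (a := m), Nat.cast_ite, Nat.cast_one, Nat.cast_zero]

lemma PrGnm_avoids {n : ℕ} (m : ℕ) {D : Finset (Fin n × Fin n)} (hD : IsOriented D) :
    PrGnm n m {f | Avoids D f} =
      oriCount (n.choose 2 - D.card) D.card m / oriCount (n.choose 2) 0 m := by
  rw [PrGnm, prWeight_eq_sum _ (Fintype.piFinset (allowed D)) (avoids_iff D),
    ← Finset.sum_filter, Finset.sum_const, nsmul_eq_mul, card_avoids m hD, oriCount_zero_right,
    div_eq_mul_inv]

lemma PrGnm_mul_le {n m : ℕ} (hm : m ≤ n.choose 2) {p : ℝ} (hp0 : 0 ≤ p) (hp1 : p ≤ 1)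
    (E : Set (Config n)) :
    PrGnm n m E * ((n.choose 2).choose m * p ^ m * (1 - p) ^ (n.choose 2 - m)) ≤
      PrGnp n p E := by
  classical
  rw [PrGnm, PrGnp, prWeight, prWeight, Finset.sum_mul]
  refine Finset.sum_le_sum fun f _ => ?_
  have hnn : ∀ o, 0 ≤ edgeWeight p o := by
    rintro (_ | _) <;> simp only [edgeWeight] <;> linarith
  by_cases hf : f ∈ E
  · rw [Set.indicator_of_mem hf, Set.indicator_of_mem hf]
    split_ifs with h
    · have : ∀ o : Option Bool, edgeWeight p o = if o.isSome then p / 2 else 1 - p := by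
        rintro (_ | _) <;> simp [edgeWeight]
      simp only [this]
      rw [Finset.prod_ite, Finset.prod_const, Finset.prod_const]
      have h2 : (univ.filter fun e : Edge n => ¬ (f e).isSome = true).card
          = n.choose 2 - m := by
        have := Finset.card_filter_add_card_filter_not (s := (univ : Finset (Edge n)))
          (fun e => (f e).isSome = true)
        rw [Finset.card_univ, card_edge] at this
        rw [← h, edgeCount]
        omega
      rw [h2]
      have h3 : (univ.filter fun e : Edge n => (f e).isSome = true).card = m := h
      rw [h3]
      have : ((n.choose 2).choose m : ℝ) ≠ 0 := by
        exact_mod_cast (Nat.choose_pos hm).ne'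
      apply le_of_eq
      rw [div_pow]
      field_simp
    · rw [zero_mul]
      exact Finset.prod_nonneg fun e _ => hnn _
  · rw [Set.indicator_of_notMem hf, Set.indicator_of_notMem hf, zero_mul]

/-- The most likely value of a binomial variable with integer mean is its mean. -/
lemma choose_mul_pow_le {N m : ℕ} (hm : m ≤ N) (j : ℕ) (hj : j ≤ N) :
    N.choose j * m ^ j * (N - m) ^ (N - j) ≤ N.choose m * m ^ m * (N - m) ^ (N - m) := by
  have step : ∀ j, j < N → N.choose (j + 1) * m ^ (j + 1) * (N - m) ^ (N - (j + 1)) *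
      ((j + 1) * (N - m)) =
      N.choose j * m ^ j * (N - m) ^ (N - j) * ((N - j) * m) := by
    intro j hj
    have h1 := Nat.choose_succ_right_eq N j
    have h2 : N - j = (N - (j + 1)) + 1 := by omega
    calc _ = (N.choose (j + 1) * (j + 1)) * m ^ j * m * ((N - m) ^ (N - (j + 1)) * (N - m)) := by
            ring
      _ = (N.choose j * (N - j)) * m ^ j * m * (N - m) ^ (N - j) := by
            rw [h1, ← pow_succ, ← h2]
      _ = _ := by ring
  rcases le_total j m with h | h
  · induction h using Nat.decreasingInduction with
    | self => exact le_rfl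
    | of_succ k hk ih =>
      refine le_trans ?_ (ih (by omega))
      have := step k (by omega)
      have h3 : (k + 1) * (N - m) ≤ (N - k) * m := by
        obtain ⟨d, rfl⟩ := Nat.exists_eq_add_of_le hm
        obtain ⟨c, rfl⟩ := Nat.exists_eq_add_of_lt hk
        have e1 : k + c + 1 + d - (k + c + 1) = d := by omega
        have e2 : k + c + 1 + d - k = c + 1 + d := by omega
        rw [e1, e2]
        nlinarith [Nat.zero_le (k * c), Nat.zero_le (c * c), Nat.zero_le (c * d), Nat.zero_le k]
      rcases Nat.eq_zero_or_pos ((N - k) * m) with h0 | h0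
      · have : m = 0 := by
          rcases Nat.mul_eq_zero.1 h0 with h | h <;> omega
        omega
      · refine Nat.le_of_mul_le_mul_right ?_ h0
        rw [← this]
        exact Nat.mul_le_mul_left _ h3
  · induction j, h using Nat.le_induction with
    | base => exact le_rfl
    | succ k hk ih =>
      refine le_trans ?_ (ih (by omega))
      have := step k (by omega)
      have h3 : (N - k) * m ≤ (k + 1) * (N - m) := by
        obtain ⟨c, rfl⟩ := Nat.exists_eq_add_of_le hk
        obtain ⟨d, rfl⟩ := Nat.exists_eq_add_of_lt hj
        have e1 : m + c + d + 1 - (m + c) = d + 1 := by omega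
        have e2 : m + c + d + 1 - m = c + d + 1 := by omega
        rw [e1, e2]
        nlinarith [Nat.zero_le (m * c), Nat.zero_le (c * c), Nat.zero_le (c * d)]
      rcases Nat.eq_zero_or_pos ((k + 1) * (N - m)) with h0 | h0
      · rcases Nat.mul_eq_zero.1 h0 with h | h <;> omega
      · refine Nat.le_of_mul_le_mul_right ?_ h0
        rw [this]
        exact Nat.mul_le_mul_left _ h3

lemma one_le_mul_choose_mul_pow {N m : ℕ} (hm : m ≤ N) (hN : 0 < N) :
    (1 : ℝ) ≤ (N + 1) * (N.choose m * (m / N : ℝ) ^ m * (1 - m / N : ℝ) ^ (N - m)) := by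
  have h1 : N ^ N ≤ (N + 1) * (N.choose m * m ^ m * (N - m) ^ (N - m)) := by
    calc N ^ N = (m + (N - m)) ^ N := by rw [Nat.add_sub_cancel' hm]
      _ = ∑ j ∈ range (N + 1), N.choose j * m ^ j * (N - m) ^ (N - j) := by
          rw [add_pow]
          exact Finset.sum_congr rfl fun j _ => by simp; ring
      _ ≤ ∑ j ∈ range (N + 1), N.choose m * m ^ m * (N - m) ^ (N - m) :=
          Finset.sum_le_sum fun j hj => choose_mul_pow_le hm j (by simpa [Nat.lt_succ_iff] using hj)
      _ = _ := by simp
  have h2 : (N : ℝ) ^ N ≤ (N + 1) * (N.choose m * m ^ m * (N - m : ℝ) ^ (N - m)) := by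
    have : ((N - m : ℕ) : ℝ) = (N : ℝ) - m := Nat.cast_sub hm
    rw [← this]
    exact_mod_cast h1
  have hN' : (0 : ℝ) < N := by exact_mod_cast hN
  have h3 : (1 - m / N : ℝ) = (N - m) / N := by field_simp
  have h4 : (N : ℝ) ^ N = N ^ m * N ^ (N - m) := by rw [← pow_add, Nat.add_sub_cancel' hm]
  rw [h3, div_pow, div_pow]
  have h5 : ((N : ℝ) + 1) *
      (N.choose m * ((m : ℝ) ^ m / N ^ m) * ((N - m : ℝ) ^ (N - m) / N ^ (N - m)))
      = (N + 1) * (N.choose m * m ^ m * (N - m : ℝ) ^ (N - m)) / N ^ N := by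
    rw [h4]; field_simp
  rw [h5, one_le_div (by positivity)]
  exact h2

lemma prWeight_nonneg {α : Type*} [Fintype α] {w : α → ℝ} (hw : ∀ x, 0 ≤ w x) (E : Set α) :
    0 ≤ prWeight w E :=
  Finset.sum_nonneg fun x _ => Set.indicator_nonneg (fun x _ => hw x) x

lemma prWeight_mono {α : Type*} [Fintype α] {w : α → ℝ} (hw : ∀ x, 0 ≤ w x) {E F : Set α}
    (h : E ⊆ F) : prWeight w E ≤ prWeight w F :=
  Finset.sum_le_sum fun x _ => Set.indicator_le_indicator_of_subset h hw x

lemma prWeight_iUnion_le {α ι : Type*} [Fintype α] {w : α → ℝ} (hw : ∀ x, 0 ≤ w x)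
    (s : Finset ι) (E : ι → Set α) :
    prWeight w (⋃ i ∈ s, E i) ≤ ∑ i ∈ s, prWeight w (E i) := by
  classical
  simp only [prWeight]
  rw [Finset.sum_comm]
  refine Finset.sum_le_sum fun x _ => ?_
  by_cases hx : x ∈ ⋃ i ∈ s, E i
  · rw [Set.indicator_of_mem hx]
    simp only [Set.mem_iUnion] at hx
    obtain ⟨i, hi, hx⟩ := hx
    refine le_trans (le_of_eq (Set.indicator_of_mem hx w).symm)
      (Finset.single_le_sum (f := fun i => (E i).indicator w x)
        (fun i _ => Set.indicator_nonneg (fun x _ => hw x) x) hi)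
  · rw [Set.indicator_of_notMem hx]
    exact Finset.sum_nonneg fun i _ => Set.indicator_nonneg (fun x _ => hw x) x

lemma gnmWeight_nonneg (n m : ℕ) (f : Config n) :
    0 ≤ (if edgeCount f = m then ((Nat.choose (Nat.choose n 2) m : ℝ) * 2 ^ m)⁻¹ else 0) := by
  split_ifs <;> positivity

lemma gnpWeight_nonneg {n : ℕ} {p : ℝ} (hp0 : 0 ≤ p) (hp1 : p ≤ 1) (f : Config n) :
    0 ≤ ∏ e : Edge n, edgeWeight p (f e) := by
  refine Finset.prod_nonneg fun e _ => ?_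
  rcases f e with _ | _ <;> simp only [edgeWeight] <;> linarith

lemma PrGnm_nonneg (n m : ℕ) (E : Set (Config n)) : 0 ≤ PrGnm n m E :=
  prWeight_nonneg (gnmWeight_nonneg n m) E

lemma PrGnm_le_mul_PrGnp {n m : ℕ} (hm : m ≤ n.choose 2) (hn : 0 < n.choose 2)
    (E : Set (Config n)) :
    PrGnm n m E ≤ (n.choose 2 + 1) * PrGnp n (m / n.choose 2 : ℝ) E := by
  have hN : (0 : ℝ) < n.choose 2 := by exact_mod_cast hn
  have h1 : (m / n.choose 2 : ℝ) ≤ 1 := by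
    rw [div_le_one hN]; exact_mod_cast hm
  have h2 := PrGnm_mul_le hm (p := (m / n.choose 2 : ℝ)) (by positivity) h1 E
  have h3 := one_le_mul_choose_mul_pow hm hn
  have h4 := PrGnm_nonneg n m E
  calc PrGnm n m E = PrGnm n m E * 1 := (mul_one _).symm
    _ ≤ PrGnm n m E * _ := mul_le_mul_of_nonneg_left h3 h4
    _ = (n.choose 2 + 1) * (PrGnm n m E * _) := by ring
    _ ≤ _ := mul_le_mul_of_nonneg_left h2 (by positivity)

end Probability

section Structure

open Finset

variable {n : ℕ}

lemma card_add_compl (S : Finset (Fin n)) : S.card + Sᶜ.card = n := by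
  rw [Finset.card_add_card_compl, Fintype.card_fin]

/-- No directed edge of `f` leaves `S`. -/
def OutClosed (f : Config n) (S : Finset (Fin n)) : Prop :=
  ∀ u ∈ S, ∀ v ∉ S, ¬ DirEdge f u v

lemma OutClosed.not_reaches {f : Config n} {S : Finset (Fin n)} (h : OutClosed f S) {u v : Fin n}
    (hu : u ∈ S) (hv : v ∉ S) : ¬ Reaches f u v := by
  intro hr
  apply hv
  clear hv
  induction hr with
  | refl => exact hu
  | tail _ hcd ih =>
    by_contra hd
    exact h _ ih _ hd hcd

lemma OutClosed.union {f : Config n} {S T : Finset (Fin n)} (hS : OutClosed f S)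
    (hT : OutClosed f T) : OutClosed f (S ∪ T) := by
  intro u hu v hv
  simp only [mem_union, not_or] at hu hv
  exact hu.elim (fun h => hS u h v hv.1) (fun h => hT u h v hv.2)

lemma OutClosed.inter {f : Config n} {S T : Finset (Fin n)} (hS : OutClosed f S)
    (hT : OutClosed f T) : OutClosed f (S ∩ T) := by
  intro u hu v hv
  simp only [mem_inter, not_and_or] at hu hv
  exact hv.elim (fun h => hS u hu.1 v h) (fun h => hT u hu.2 v h)

lemma exists_outClosed {f : Config n} {u v : Fin n} (h : ¬ Reaches f u v) :
    ∃ S : Finset (Fin n), OutClosed f S ∧ u ∈ S ∧ v ∉ S := by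
  classical
  refine ⟨univ.filter fun w => Reaches f u w, ?_, ?_, ?_⟩
  · intro x hx y hy hxy
    simp only [mem_filter, mem_univ, true_and] at hx hy
    exact hy (hx.tail hxy)
  · exact mem_filter.2 ⟨mem_univ _, Relation.ReflTransGen.refl⟩
  · simpa using h

/-- The directed edges leaving `U`, and those entering `Z \ U`, across the cut `(Z, Zᶜ)`. -/
def cutEdges (Z U : Finset (Fin n)) : Finset (Fin n × Fin n) :=
  U ×ˢ Zᶜ ∪ Zᶜ ×ˢ (Z \ U)

lemma isOriented_cutEdges {Z U : Finset (Fin n)} (h : U ⊆ Z) : IsOriented (cutEdges Z U) := by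
  intro u v huv
  simp only [cutEdges, mem_union, mem_product, mem_compl, Finset.mem_sdiff] at huv ⊢
  have := @h u
  have := @h v
  refine ⟨?_, by tauto⟩
  rintro rfl
  tauto

lemma card_cutEdges {Z U : Finset (Fin n)} (h : U ⊆ Z) :
    (cutEdges Z U).card = Z.card * (n - Z.card) := by
  rw [cutEdges, Finset.card_union_of_disjoint, card_product, card_product, card_compl,
    Fintype.card_fin, mul_comm (n - Z.card), ← add_mul, Finset.card_sdiff_of_subset h,
    Nat.add_sub_cancel' (card_le_card h)]
  rw [Finset.disjoint_left]
  rintro ⟨u, v⟩ h1 h2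
  simp only [mem_product, mem_compl] at h1 h2
  exact h2.1 (h h1.1)

/-- The configurations with a set of between `t` and `n / 2` vertices, each of which has either no
edge to, or no edge from, the complement of the set. -/
def badCut (n t : ℕ) : Set (Config n) :=
  ⋃ Z ∈ univ.filter fun Z : Finset (Fin n) => t ≤ Z.card ∧ 2 * Z.card ≤ n,
    ⋃ U ∈ Z.powerset, {f | Avoids (cutEdges Z U) f}

/-- The configurations with a vertex isolated from some `n - 4` other vertices. -/
def nearIsolated (n : ℕ) : Set (Config n) :=
  ⋃ x ∈ (univ : Finset (Fin n)),
    ⋃ Y ∈ (powersetCard (n - 4) (univ : Finset (Fin n))).filter fun Y => x ∉ Y,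
      {f | Avoids ({x} ×ˢ Y ∪ ({x} ×ˢ Y).map (Equiv.prodComm _ _).toEmbedding) f}

lemma mem_badCut {f : Config n} {t : ℕ} (Z U : Finset (Fin n)) (hU : U ⊆ Z) (ht : t ≤ Z.card)
    (hZ : 2 * Z.card ≤ n) (h1 : ∀ u ∈ U, ∀ v ∉ Z, ¬ DirEdge f u v)
    (h2 : ∀ u ∈ Z, u ∉ U → ∀ v ∉ Z, ¬ DirEdge f v u) : f ∈ badCut n t := by
  simp only [badCut, Set.mem_iUnion, mem_filter, mem_univ, true_and, mem_powerset,
    Set.mem_ofPred_eq]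
  refine ⟨Z, ⟨ht, hZ⟩, U, hU, ?_⟩
  rintro ⟨u, v⟩ huv
  simp only [cutEdges, mem_union, mem_product, mem_compl, Finset.mem_sdiff] at huv
  rcases huv with ⟨h, h'⟩ | ⟨h, h'⟩
  · exact h1 u h v h'
  · exact h2 v h'.1 h'.2 u h

lemma OutClosed.card_lt {f : Config n} {t : ℕ} (hf : f ∉ badCut n t) {S : Finset (Fin n)}
    (hS : OutClosed f S) : S.card < t ∨ Sᶜ.card < t := by
  by_contra! h
  have hc : S.card + Sᶜ.card = n := card_add_compl _
  rcases le_total S.card Sᶜ.card with h' | h'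
  · exact hf (mem_badCut S S subset_rfl h.1 (by omega) hS (fun u hu hu' => absurd hu hu'))
  · refine hf (mem_badCut Sᶜ ∅ (empty_subset _) h.2 (by omega) (by simp) ?_)
    intro u hu _ v hv
    simp only [mem_compl, not_not] at hu hv
    exact hS v hv u hu

lemma mem_nearIsolated {f : Config n} {S T : Finset (Fin n)} (hS : OutClosed f S)
    (hT : OutClosed f T) {x : Fin n} (hxS : x ∈ S) (hxT : x ∉ T)
    (hc : n - 4 ≤ (Sᶜ ∩ T).card) : f ∈ nearIsolated n := by
  obtain ⟨Y, hY, hYc⟩ := exists_subset_card_eq hc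
  simp only [nearIsolated, Set.mem_iUnion, mem_filter, mem_powersetCard, mem_univ,
    Set.mem_ofPred_eq]
  refine ⟨x, trivial, Y, ⟨⟨subset_univ _, hYc⟩, fun h => ?_⟩, ?_⟩
  · exact hxT (mem_inter.1 (hY h)).2
  · rintro ⟨u, v⟩ huv
    simp only [mem_union, mem_product, mem_singleton, Finset.mem_map, Prod.exists,
      Equiv.coe_toEmbedding, Equiv.prodComm_apply, Prod.swap_prod_mk, Prod.mk.injEq] at huv
    rcases huv with ⟨rfl, h⟩ | ⟨y, z, ⟨rfl, h⟩, rfl, rfl⟩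
    · have := mem_inter.1 (hY h)
      exact hS _ hxS _ (mem_compl.1 this.1)
    · have := mem_inter.1 (hY h)
      exact hT _ this.2 _ hxT

/-- The directed edges leaving `s`. -/
def outEdges (s : Fin n) : Finset (Fin n × Fin n) := {s} ×ˢ {s}ᶜ

/-- The directed edges entering `a`. -/
def inEdges (a : Fin n) : Finset (Fin n × Fin n) := {a}ᶜ ×ˢ {a}

/-- The directed edges leaving `{s, b}`, and the edge from `b` to `s`. -/
def pairOutEdges (s b : Fin n) : Finset (Fin n × Fin n) := {s, b} ×ˢ {s, b}ᶜ ∪ {(b, s)}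

/-- The directed edges entering `{s, a}`, and the edge from `s` to `a`. -/
def pairInEdges (s a : Fin n) : Finset (Fin n × Fin n) := {s, a}ᶜ ×ˢ {s, a} ∪ {(s, a)}

lemma avoids_outEdges {f : Config n} {s : Fin n} :
    Avoids (outEdges s) f ↔ ∀ v, v ≠ s → ¬ DirEdge f s v := by
  simp [Avoids, outEdges]

lemma avoids_inEdges {f : Config n} {a : Fin n} :
    Avoids (inEdges a) f ↔ ∀ v, v ≠ a → ¬ DirEdge f v a := by
  simp only [Avoids, inEdges, mem_product, mem_compl, mem_singleton, Prod.forall]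
  exact ⟨fun h v hv => h v a ⟨hv, rfl⟩, fun h u v ⟨h1, h2⟩ => h2 ▸ h u (h2 ▸ h1)⟩

lemma avoids_union {f : Config n} {D E : Finset (Fin n × Fin n)} :
    Avoids (D ∪ E) f ↔ Avoids D f ∧ Avoids E f := by
  simp only [Avoids, mem_union, or_imp, forall_and]

lemma avoids_pairOutEdges {f : Config n} {s b : Fin n} :
    Avoids (pairOutEdges s b) f ↔
      (∀ v, v ≠ s → v ≠ b → ¬ DirEdge f s v ∧ ¬ DirEdge f b v) ∧ ¬ DirEdge f b s := by
  rw [pairOutEdges, avoids_union]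
  simp only [Avoids, mem_product, mem_compl, mem_insert, mem_singleton, Prod.forall]
  constructor
  · rintro ⟨h1, h2⟩
    exact ⟨fun v h h' => ⟨h1 s v (by tauto), h1 b v (by tauto)⟩, h2 b s rfl⟩
  · rintro ⟨h1, h2⟩
    refine ⟨?_, ?_⟩
    · rintro u v ⟨rfl | rfl, h⟩
      · exact (h1 v (by tauto) (by tauto)).1
      · exact (h1 v (by tauto) (by tauto)).2
    · rintro u v h
      obtain ⟨rfl, rfl⟩ := Prod.mk.inj h
      exact h2

lemma avoids_pairInEdges {f : Config n} {s a : Fin n} :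
    Avoids (pairInEdges s a) f ↔
      (∀ v, v ≠ s → v ≠ a → ¬ DirEdge f v s ∧ ¬ DirEdge f v a) ∧ ¬ DirEdge f s a := by
  rw [pairInEdges, avoids_union]
  simp only [Avoids, mem_product, mem_compl, mem_insert, mem_singleton, Prod.forall]
  constructor
  · rintro ⟨h1, h2⟩
    exact ⟨fun v h h' => ⟨h1 v s (by tauto), h1 v a (by tauto)⟩, h2 s a rfl⟩
  · rintro ⟨h1, h2⟩
    refine ⟨?_, ?_⟩
    · rintro u v ⟨h, rfl | rfl⟩
      · exact (h1 u (by tauto) (by tauto)).1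
      · exact (h1 u (by tauto) (by tauto)).2
    · rintro u v h
      obtain ⟨rfl, rfl⟩ := Prod.mk.inj h
      exact h2

lemma isOriented_outEdges (s : Fin n) : IsOriented (outEdges s) := by
  intro u v h
  simp only [outEdges, mem_product, mem_compl, mem_singleton] at h ⊢
  grind

lemma isOriented_inEdges (s : Fin n) : IsOriented (inEdges s) := by
  intro u v h
  simp only [inEdges, mem_product, mem_compl, mem_singleton] at h ⊢
  grind

lemma isOriented_pairOutEdges {s b : Fin n} (h : s ≠ b) : IsOriented (pairOutEdges s b) := by
  intro u v h
  simp only [pairOutEdges, mem_union, mem_product, mem_compl, mem_insert, mem_singleton,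
    Prod.mk.injEq] at h ⊢
  grind

lemma isOriented_pairInEdges {s a : Fin n} (h : s ≠ a) : IsOriented (pairInEdges s a) := by
  intro u v h
  simp only [pairInEdges, mem_union, mem_product, mem_compl, mem_insert, mem_singleton,
    Prod.mk.injEq] at h ⊢
  grind

lemma isOriented_outEdges_union_inEdges {a b : Fin n} (h : a ≠ b) :
    IsOriented (outEdges b ∪ inEdges a) := by
  intro u v h
  simp only [outEdges, inEdges, mem_union, mem_product, mem_compl, mem_singleton] at h ⊢
  grind

lemma card_outEdges (s : Fin n) : (outEdges s).card = n - 1 := by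
  simp [outEdges, card_compl]

lemma card_inEdges (s : Fin n) : (inEdges s).card = n - 1 := by
  simp [inEdges, card_compl]

lemma card_pairOutEdges {s b : Fin n} (h : s ≠ b) :
    (pairOutEdges s b).card = 2 * (n - 2) + 1 := by
  rw [pairOutEdges, card_union_of_disjoint]
  · rw [card_product, card_compl, card_pair h, Fintype.card_fin, card_singleton]
  · simp

lemma card_pairInEdges {s a : Fin n} (h : s ≠ a) :
    (pairInEdges s a).card = 2 * (n - 2) + 1 := by
  rw [pairInEdges, card_union_of_disjoint]
  · rw [card_product, card_compl, card_pair h, Fintype.card_fin, card_singleton, mul_comm]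
  · simp

lemma card_outEdges_union_inEdges {a b : Fin n} (h : a ≠ b) :
    (outEdges b ∪ inEdges a).card = 2 * (n - 2) + 1 := by
  have hi : outEdges b ∩ inEdges a = {(b, a)} := by
    ext ⟨u, v⟩
    simp only [outEdges, inEdges, mem_inter, mem_product, mem_compl, mem_singleton, Prod.mk.injEq]
    grind
  have := card_union_add_card_inter (outEdges b) (inEdges a)
  rw [hi, card_singleton, card_outEdges, card_inEdges] at this
  have h2 : 2 ≤ n := by
    have := Fin.val_ne_of_ne h
    omega
  omega

lemma not_reaches_of_outEdges {f : Config n} {s a : Fin n} (h : s ≠ a)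
    (hf : Avoids (outEdges s) f) : ¬ Reaches f s a := by
  rw [avoids_outEdges] at hf
  refine OutClosed.not_reaches (S := {s}) ?_ (by simp) (by simpa using h.symm)
  intro u hu v hv
  simp only [mem_singleton] at hu hv
  exact hu ▸ hf v hv

lemma not_reaches_of_inEdges {f : Config n} {s a : Fin n} (h : s ≠ a)
    (hf : Avoids (inEdges a) f) : ¬ Reaches f s a := by
  rw [avoids_inEdges] at hf
  refine OutClosed.not_reaches (S := {a}ᶜ) ?_ (by simpa using h) (by simp)
  intro u hu v hv
  simp only [mem_compl, mem_singleton, not_not] at hu hv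
  exact hv ▸ hf u hu

lemma avoids_of_not_reaches {f : Config n} (hf : f ∉ badCut n 2) {s a : Fin n}
    (h : ¬ Reaches f s a) : Avoids (outEdges s) f ∨ Avoids (inEdges a) f := by
  obtain ⟨S, hS, hs, ha⟩ := exists_outClosed h
  rw [avoids_outEdges, avoids_inEdges]
  rcases hS.card_lt hf with hc | hc
  · left
    have := card_le_one.1 (Nat.lt_succ_iff.1 hc)
    exact fun v hv => hS s hs v fun hv' => hv (this v hv' s hs)
  · right
    have := card_le_one.1 (Nat.lt_succ_iff.1 hc)
    intro v hv
    refine hS v ?_ a ha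
    by_contra hv'
    exact hv (this v (mem_compl.2 hv') a (mem_compl.2 ha))

lemma not_avoids_out_in {f : Config n} (hn : 4 ≤ n) (hf : f ∉ badCut n 2) {s a : Fin n}
    (hsa : s ≠ a) : ¬ (Avoids (outEdges s) f ∧ Avoids (inEdges a) f) := by
  rw [avoids_outEdges, avoids_inEdges]
  rintro ⟨h1, h2⟩
  refine hf (mem_badCut {s, a} {s} (by simp) (by rw [card_pair hsa]) (by rw [card_pair hsa]; omega)
    ?_ ?_)
  · intro u hu v hv
    simp only [mem_insert, mem_singleton, not_or] at hu hv
    exact hu ▸ h1 v hv.1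
  · intro u hu hu' v hv
    simp only [mem_insert, mem_singleton, not_or] at hu hu' hv
    have : u = a := by tauto
    exact this ▸ h2 v hv.2

section Joint

variable {f : Config n} {s a b : Fin n}

lemma not_reaches_of_pairOutEdges (hsa : s ≠ a) (hsb : s ≠ b) (hab : a ≠ b)
    (hf : Avoids (pairOutEdges s b) f) : ¬ Reaches f s a ∧ ¬ Reaches f b s := by
  rw [avoids_pairOutEdges] at hf
  constructor
  · refine OutClosed.not_reaches (S := {s, b}) ?_ (by simp) (by simp [hsa.symm, hab])
    intro u hu v hv
    simp only [mem_insert, mem_singleton, not_or] at hu hv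
    have := hf.1 v hv.1 hv.2
    rcases hu with rfl | rfl
    exacts [this.1, this.2]
  · refine not_reaches_of_outEdges hsb.symm ?_
    rw [avoids_outEdges]
    intro v hv
    by_cases hvs : v = s
    · exact hvs ▸ hf.2
    · exact (hf.1 v hvs hv).2

lemma not_reaches_of_pairInEdges (hsa : s ≠ a) (hsb : s ≠ b) (hab : a ≠ b)
    (hf : Avoids (pairInEdges s a) f) : ¬ Reaches f s a ∧ ¬ Reaches f b s := by
  rw [avoids_pairInEdges] at hf
  constructor
  · refine not_reaches_of_inEdges hsa ?_
    rw [avoids_inEdges]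
    intro v hv
    by_cases hvs : v = s
    · exact hvs ▸ hf.2
    · exact (hf.1 v hvs hv).2
  · refine OutClosed.not_reaches (S := {s, a}ᶜ) ?_ (by simp [hsb.symm, hab.symm]) (by simp)
    intro u hu v hv
    simp only [mem_compl, mem_insert, mem_singleton, not_or, not_and_or, not_not] at hu hv
    have := hf.1 u hu.1 hu.2
    rcases hv with rfl | rfl
    exacts [this.1, this.2]

lemma not_reaches_of_out_in (hsa : s ≠ a) (hsb : s ≠ b)
    (hf : Avoids (outEdges b ∪ inEdges a) f) : ¬ Reaches f s a ∧ ¬ Reaches f b s := by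
  rw [avoids_union] at hf
  exact ⟨not_reaches_of_inEdges hsa hf.2, not_reaches_of_outEdges hsb.symm hf.1⟩

lemma mem_badCut_of_pairOutEdges (hn : 6 ≤ n) (hsa : s ≠ a) (hsb : s ≠ b) (hab : a ≠ b)
    (h1 : Avoids (pairOutEdges s b) f) (h2 : ∀ v, v ≠ s → v ≠ a → ¬ DirEdge f v a) :
    f ∈ badCut n 3 := by
  rw [avoids_pairOutEdges] at h1
  have hc : ({s, a, b} : Finset (Fin n)).card = 3 := card_eq_three.2 ⟨s, a, b, hsa, hsb, hab, rfl⟩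
  refine mem_badCut {s, a, b} {s, b} (by grind) hc.ge (by omega) ?_ ?_
  · intro u hu v hv
    simp only [mem_insert, mem_singleton, not_or] at hu hv
    have := h1.1 v hv.1 hv.2.2
    rcases hu with rfl | rfl
    exacts [this.1, this.2]
  · intro u hu hu' v hv
    simp only [mem_insert, mem_singleton, not_or] at hu hu' hv
    have : u = a := by tauto
    exact this ▸ h2 v hv.1 hv.2.1

lemma mem_badCut_of_pairInEdges (hn : 6 ≤ n) (hsa : s ≠ a) (hsb : s ≠ b) (hab : a ≠ b)
    (h1 : Avoids (pairInEdges s a) f) (h2 : Avoids (outEdges b) f) :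
    f ∈ badCut n 3 := by
  rw [avoids_pairInEdges] at h1
  rw [avoids_outEdges] at h2
  have hc : ({s, a, b} : Finset (Fin n)).card = 3 := card_eq_three.2 ⟨s, a, b, hsa, hsb, hab, rfl⟩
  refine mem_badCut {s, a, b} {b} (by grind) hc.ge (by omega) ?_ ?_
  · intro u hu v hv
    simp only [mem_insert, mem_singleton, not_or] at hu hv
    exact hu ▸ h2 v hv.2.2
  · intro u hu hu' v hv
    simp only [mem_insert, mem_singleton, not_or] at hu hu' hv
    have := h1.1 v hv.1 hv.2.1
    rcases hu with rfl | rfl | rfl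
    exacts [this.1, this.2, absurd rfl hu']

lemma avoids_of_not_reaches_of_not_reaches (hn : 8 ≤ n) (hf : f ∉ badCut n 3)
    (hf' : f ∉ nearIsolated n) (hsa : s ≠ a) (hsb : s ≠ b) (h1 : ¬ Reaches f s a)
    (h2 : ¬ Reaches f b s) :
    Avoids (pairOutEdges s b) f ∨ Avoids (pairInEdges s a) f ∨
      Avoids (outEdges b ∪ inEdges a) f := by
  obtain ⟨S, hS, hsS, haS⟩ := exists_outClosed h1
  obtain ⟨T, hT, hbT, hsT⟩ := exists_outClosed h2
  have cS : S.card + Sᶜ.card = n := card_add_compl _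
  have cT : T.card + Tᶜ.card = n := card_add_compl _
  have key : ∀ x, x ∈ S → x ∉ T → S.card < 3 → Tᶜ.card < 3 → False := by
    intro x hxS hxT h h'
    refine hf' (mem_nearIsolated hS hT hxS hxT ?_)
    have e : (Sᶜ ∩ T)ᶜ = S ∪ Tᶜ := by simp [compl_inter]
    have := card_union_le S Tᶜ
    have := Finset.card_add_card_compl (Sᶜ ∩ T)
    rw [e, Fintype.card_fin] at this
    omega
  have key' : ∀ x, x ∈ T → x ∉ S → Sᶜ.card < 3 → T.card < 3 → False := by
    intro x hxT hxS h h'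
    refine hf' (mem_nearIsolated hT hS hxT hxS ?_)
    have e : (Tᶜ ∩ S)ᶜ = T ∪ Sᶜ := by simp [compl_inter]
    have := card_union_le T Sᶜ
    have := Finset.card_add_card_compl (Tᶜ ∩ S)
    rw [e, Fintype.card_fin] at this
    omega
  rcases hS.card_lt hf with hcS | hcS <;> rcases hT.card_lt hf with hcT | hcT
  · left
    have hU := (hS.union hT).card_lt hf
    have h3 := card_union_le S T
    have h4 : (S ∪ T).card + (S ∪ T)ᶜ.card = n := card_add_compl _
    have h5 : ({s, b} : Finset (Fin n)) = S ∪ T := by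
      refine eq_of_subset_of_card_le ?_ ?_
      · intro x hx
        simp only [mem_insert, mem_singleton] at hx
        rcases hx with rfl | rfl <;> simp [*]
      · rw [card_pair hsb]; omega
    have hU' := hS.union hT
    rw [← h5] at hU'
    rw [avoids_pairOutEdges]
    refine ⟨fun v hv hv' => ⟨hU' s (by simp) v (by simp [hv, hv']),
      hU' b (by simp) v (by simp [hv, hv'])⟩,
      hT b hbT s hsT⟩
  · exact (key s hsS hsT hcS hcT).elim
  · by_cases hbS : b ∈ S
    swap
    · exact (key' b hbT hbS hcS hcT).elim
    by_cases haT : a ∈ T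
    · exact (key' a haT haS hcS hcT).elim
    have hTS : ∀ x ∈ T, x ∉ Sᶜ := fun x hx hx' => key' x hx (mem_compl.1 hx') hcS hcT
    have hdis : Disjoint T Sᶜ := Finset.disjoint_left.2 hTS
    have hcard := card_union_of_disjoint hdis
    by_cases h3 : 3 ≤ T.card + Sᶜ.card
    · refine (hf (mem_badCut (T ∪ Sᶜ) T subset_union_left (by omega) (by omega) ?_ ?_)).elim
      · intro u hu v hv
        simp only [mem_union, not_or] at hv
        exact hT u hu v hv.1
      · intro u hu hu' v hv
        simp only [mem_union, mem_compl, not_or, not_not] at hu hv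
        exact hS v hv.2 u (by tauto)
    · have p1 : 0 < T.card := card_pos.2 ⟨b, hbT⟩
      have p2 : 0 < Sᶜ.card := card_pos.2 ⟨a, mem_compl.2 haS⟩
      have q1 := card_le_one.1 (show T.card ≤ 1 by omega)
      have q2 := card_le_one.1 (show Sᶜ.card ≤ 1 by omega)
      right; right
      rw [avoids_union, avoids_outEdges, avoids_inEdges]
      refine ⟨fun v hv => hT b hbT v fun hv' => hv (q1 v hv' b hbT), fun v hv => hS v ?_ a haS⟩
      by_contra hv'
      exact hv (q2 v (mem_compl.2 hv') a (mem_compl.2 haS))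
  · right; left
    have hU' := hS.inter hT
    have hU := hU'.card_lt hf
    have h3 := card_union_le Sᶜ Tᶜ
    have h4 : (S ∩ T).card + (S ∩ T)ᶜ.card = n := card_add_compl _
    have h6 : (S ∩ T)ᶜ = Sᶜ ∪ Tᶜ := compl_inter _ _
    rw [← h6] at h3
    have h5 : ({s, a} : Finset (Fin n)) = (S ∩ T)ᶜ := by
      refine eq_of_subset_of_card_le ?_ ?_
      · intro x hx
        simp only [mem_insert, mem_singleton] at hx
        rcases hx with rfl | rfl <;> simp [*]
      · rw [card_pair hsa]; omega
    rw [avoids_pairInEdges]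
    have hm : ∀ v, v ≠ s → v ≠ a → v ∈ S ∩ T := by
      intro v hv hv'
      by_contra h
      rw [← mem_compl, ← h5] at h
      simp [hv, hv'] at h
    refine ⟨fun v hv hv' => ⟨hU' v (hm v hv hv') s (by simp [hsT]),
      hU' v (hm v hv hv') a (by simp [haS])⟩, hS s hsS a haS⟩

end Joint

end Structure

section Bounds

open Finset

lemma PrGnp_badCut_le {n t : ℕ} {p : ℝ} (hp0 : 0 ≤ p) (hp1 : p ≤ 1)
    (h : 2 * n * (1 - p / 2) ^ (n / 2 - t) ≤ 1) :
    PrGnp n p (badCut n t) ≤ (n + 1) * (2 * n) ^ t * (1 - p / 2) ^ (t * (n - t)) := by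
  have hq0 : 0 ≤ 1 - p / 2 := by linarith
  have hq1 : 1 - p / 2 ≤ 1 := by linarith
  have hnn := gnpWeight_nonneg (n := n) hp0 hp1
  calc PrGnp n p (badCut n t)
      ≤ ∑ Z ∈ univ.filter fun Z : Finset (Fin n) => t ≤ Z.card ∧ 2 * Z.card ≤ n,
          ∑ U ∈ Z.powerset, PrGnp n p {f | Avoids (cutEdges Z U) f} :=
        (prWeight_iUnion_le hnn _ _).trans
          (Finset.sum_le_sum fun Z _ => prWeight_iUnion_le hnn _ _)
    _ = ∑ Z ∈ univ.filter fun Z : Finset (Fin n) => t ≤ Z.card ∧ 2 * Z.card ≤ n,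
          2 ^ Z.card * (1 - p / 2) ^ (Z.card * (n - Z.card)) := by
        refine Finset.sum_congr rfl fun Z _ => ?_
        rw [Finset.sum_congr rfl (g := fun _ => (1 - p / 2) ^ (Z.card * (n - Z.card)))]
        · rw [Finset.sum_const, card_powerset, nsmul_eq_mul]
          push_cast
          rfl
        · intro U hU
          rw [PrGnp_avoids p (isOriented_cutEdges (mem_powerset.1 hU)),
            card_cutEdges (mem_powerset.1 hU)]
    _ = ∑ j ∈ range (n + 1), n.choose j •
          (if t ≤ j ∧ 2 * j ≤ n then 2 ^ j * (1 - p / 2) ^ (j * (n - j)) else 0) := by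
        rw [Finset.sum_filter]
        have := Finset.sum_powerset_apply_card (x := (univ : Finset (Fin n)))
          (fun j => if t ≤ j ∧ 2 * j ≤ n then 2 ^ j * (1 - p / 2) ^ (j * (n - j)) else 0)
        rwa [powerset_univ, card_univ, Fintype.card_fin] at this
    _ ≤ ∑ j ∈ range (n + 1), (2 * n) ^ t * (1 - p / 2) ^ (t * (n - t)) := by
        refine Finset.sum_le_sum fun j _ => ?_
        split_ifs with hj
        · obtain ⟨i, rfl⟩ := Nat.exists_eq_add_of_le hj.1
          have e : (t + i) * (n - (t + i)) = t * (n - t) + i * (n - (t + i) - t) := by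
            obtain ⟨c, rfl⟩ := Nat.exists_eq_add_of_le hj.2
            have e1 : 2 * (t + i) + c - (t + i) = t + i + c := by omega
            have e2 : 2 * (t + i) + c - t = t + 2 * i + c := by omega
            have e3 : t + i + c - t = i + c := by omega
            rw [e1, e2, e3]
            ring
          have h1 : (n.choose (t + i) : ℝ) ≤ n ^ (t + i) := by
            exact_mod_cast Nat.choose_le_pow n (t + i)
          have h2 : 2 * n * (1 - p / 2) ^ (n - (t + i) - t) ≤ 1 := by
            refine le_trans ?_ h
            exact mul_le_mul_of_nonneg_left
              (pow_le_pow_of_le_one hq0 hq1 (by omega)) (by positivity)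
          rw [nsmul_eq_mul]
          calc (n.choose (t + i) : ℝ) * (2 ^ (t + i) * (1 - p / 2) ^ ((t + i) * (n - (t + i))))
              ≤ n ^ (t + i) * (2 ^ (t + i) * (1 - p / 2) ^ ((t + i) * (n - (t + i)))) :=
                mul_le_mul_of_nonneg_right h1 (by positivity)
            _ = (2 * n) ^ t * (1 - p / 2) ^ (t * (n - t)) *
                  (2 * n * (1 - p / 2) ^ (n - (t + i) - t)) ^ i := by
                rw [e, pow_add _ (t * _), mul_comm i, pow_mul (1 - p / 2) (n - (t + i) - t)]
                ring
            _ ≤ (2 * n) ^ t * (1 - p / 2) ^ (t * (n - t)) * 1 :=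
                mul_le_mul_of_nonneg_left (pow_le_one₀ (by positivity) h2) (by positivity)
            _ = _ := mul_one _
        · simp only [smul_zero]
          positivity
    _ = _ := by
        rw [Finset.sum_const, card_range, nsmul_eq_mul]
        push_cast
        ring

lemma PrGnp_nearIsolated_le {n : ℕ} (hn : 4 ≤ n) {p : ℝ} (hp0 : 0 ≤ p) (hp1 : p ≤ 1) :
    PrGnp n p (nearIsolated n) ≤ n ^ 5 * (1 - p) ^ (n - 4) := by
  have hnn := gnpWeight_nonneg (n := n) hp0 hp1
  have hq0 : 0 ≤ 1 - p := by linarith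
  calc PrGnp n p (nearIsolated n)
      ≤ ∑ x ∈ (univ : Finset (Fin n)),
          ∑ Y ∈ (powersetCard (n - 4) (univ : Finset (Fin n))).filter fun Y => x ∉ Y,
            PrGnp n p {f | Avoids ({x} ×ˢ Y ∪
              ({x} ×ˢ Y).map (Equiv.prodComm _ _).toEmbedding) f} :=
        (prWeight_iUnion_le hnn _ _).trans
          (Finset.sum_le_sum fun Z _ => prWeight_iUnion_le hnn _ _)
    _ ≤ ∑ x ∈ (univ : Finset (Fin n)), n ^ 4 * (1 - p) ^ (n - 4) := by
        refine Finset.sum_le_sum fun x _ => ?_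
        rw [Finset.sum_congr rfl (g := fun _ => (1 - p) ^ (n - 4))]
        · rw [Finset.sum_const, nsmul_eq_mul]
          refine mul_le_mul_of_nonneg_right ?_ (by positivity)
          have h1 := card_filter_le (powersetCard (n - 4) (univ : Finset (Fin n))) (x ∉ ·)
          rw [card_powersetCard, card_univ, Fintype.card_fin, Nat.choose_symm hn] at h1
          exact_mod_cast h1.trans (Nat.choose_le_pow n 4)
        · intro Y hY
          rw [mem_filter, mem_powersetCard] at hY
          rw [PrGnp_avoids_both, card_product, card_singleton, one_mul, hY.1.2]
          intro u v huv
          simp only [mem_product, mem_singleton] at huv ⊢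
          grind
    _ = _ := by
        rw [Finset.sum_const, card_univ, Fintype.card_fin, nsmul_eq_mul]
        ring

/-- The probability that `G(n,m)`, where `N` is the number of pairs of vertices, avoids `k` given
directed edges between different pairs of vertices. -/
noncomputable def avoidProb (N m k : ℕ) : ℝ :=
  oriCount (N - k) k m / oriCount N 0 m

lemma prWeight_union_add_inter {α : Type*} [Fintype α] (w : α → ℝ) (E F : Set α) :
    prWeight w (E ∪ F) + prWeight w (E ∩ F) = prWeight w E + prWeight w F := by
  simp only [prWeight, ← Finset.sum_add_distrib]
  exact Finset.sum_congr rfl fun x _ => congrFun (Set.indicator_union_add_inter w E F) x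

lemma prWeight_union_le {α : Type*} [Fintype α] {w : α → ℝ} (hw : ∀ x, 0 ≤ w x) (E F : Set α) :
    prWeight w (E ∪ F) ≤ prWeight w E + prWeight w F := by
  linarith [prWeight_union_add_inter w E F, prWeight_nonneg hw (E ∩ F)]

lemma abs_PrGnm_not_reaches_sub_le {n : ℕ} (hn : 4 ≤ n) (m : ℕ) {s a : Fin n} (hsa : s ≠ a) :
    |PrGnm n m {f | ¬ Reaches f s a} - 2 * avoidProb (n.choose 2) m (n - 1)| ≤
      PrGnm n m (badCut n 2) := by
  have h1 := PrGnm_avoids m (isOriented_outEdges s)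
  have h2 := PrGnm_avoids m (isOriented_inEdges a)
  rw [card_outEdges] at h1
  rw [card_inEdges] at h2
  rw [abs_le, avoidProb]
  have hw := gnmWeight_nonneg n m
  set A : Set (Config n) := {f | Avoids (outEdges s) f}
  set B : Set (Config n) := {f | Avoids (inEdges a) f}
  set E : Set (Config n) := {f | ¬ Reaches f s a}
  have u1 : PrGnm n m E ≤ PrGnm n m (A ∪ B ∪ badCut n 2) := by
    refine prWeight_mono hw fun f hf => ?_
    by_cases hb : f ∈ badCut n 2
    · exact Or.inr hb
    · exact Or.inl (avoids_of_not_reaches hb hf)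
  have u2 : PrGnm n m (A ∪ B) ≤ PrGnm n m E := by
    refine prWeight_mono hw ?_
    rintro f (hf | hf)
    · exact not_reaches_of_outEdges hsa hf
    · exact not_reaches_of_inEdges hsa hf
  have u3 : PrGnm n m (A ∩ B) ≤ PrGnm n m (badCut n 2) := by
    refine prWeight_mono hw fun f hf => ?_
    by_contra hb
    exact not_avoids_out_in hn hb hsa hf
  have v1 : PrGnm n m (A ∪ B ∪ badCut n 2) ≤ _ := prWeight_union_le hw _ _
  have v2 : PrGnm n m (A ∪ B) + PrGnm n m (A ∩ B) = _ := prWeight_union_add_inter _ _ _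
  have v3 := PrGnm_nonneg n m (A ∩ B)
  simp only [PrGnm] at *
  constructor <;> linarith

lemma abs_PrGnm_joint_sub_le {n : ℕ} (hn : 8 ≤ n) (m : ℕ) {s a b : Fin n} (hsa : s ≠ a)
    (hsb : s ≠ b) (hab : a ≠ b) :
    |PrGnm n m {f | ¬ Reaches f s a ∧ ¬ Reaches f b s} -
        3 * avoidProb (n.choose 2) m (2 * (n - 2) + 1)| ≤
      2 * PrGnm n m (badCut n 3) + PrGnm n m (nearIsolated n) := by
  have h1 := PrGnm_avoids m (isOriented_pairOutEdges hsb)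
  have h2 := PrGnm_avoids m (isOriented_pairInEdges hsa)
  have h3 := PrGnm_avoids m (isOriented_outEdges_union_inEdges hab)
  rw [card_pairOutEdges hsb] at h1
  rw [card_pairInEdges hsa] at h2
  rw [card_outEdges_union_inEdges hab] at h3
  rw [abs_le, avoidProb]
  have hw := gnmWeight_nonneg n m
  set A : Set (Config n) := {f | Avoids (pairOutEdges s b) f}
  set B : Set (Config n) := {f | Avoids (pairInEdges s a) f}
  set C : Set (Config n) := {f | Avoids (outEdges b ∪ inEdges a) f}
  set E : Set (Config n) := {f | ¬ Reaches f s a ∧ ¬ Reaches f b s}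
  have u1 : PrGnm n m E ≤ PrGnm n m (A ∪ B ∪ C ∪ badCut n 3 ∪ nearIsolated n) := by
    refine prWeight_mono hw fun f hf => ?_
    by_cases hb : f ∈ badCut n 3
    · exact Or.inl (Or.inr hb)
    by_cases hi : f ∈ nearIsolated n
    · exact Or.inr hi
    rcases avoids_of_not_reaches_of_not_reaches hn hb hi hsa hsb hf.1 hf.2 with h | h | h
    · exact Or.inl (Or.inl (Or.inl (Or.inl h)))
    · exact Or.inl (Or.inl (Or.inl (Or.inr h)))
    · exact Or.inl (Or.inl (Or.inr h))
  have u2 : PrGnm n m (A ∪ B ∪ C) ≤ PrGnm n m E := by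
    refine prWeight_mono hw ?_
    rintro f ((hf | hf) | hf)
    · exact not_reaches_of_pairOutEdges hsa hsb hab hf
    · exact not_reaches_of_pairInEdges hsa hsb hab hf
    · exact not_reaches_of_out_in hsa hsb hf
  have u3 : PrGnm n m (A ∩ B) ≤ PrGnm n m (badCut n 3) :=
    prWeight_mono hw fun f hf => mem_badCut_of_pairOutEdges (by omega) hsa hsb hab hf.1
      fun v h h' => ((avoids_pairInEdges.1 hf.2).1 v h h').2
  have u4 : PrGnm n m ((A ∪ B) ∩ C) ≤ PrGnm n m (badCut n 3) := by
    refine prWeight_mono hw ?_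
    rintro f ⟨hf | hf, hf'⟩ <;> have hf' := avoids_union.1 hf'
    · exact mem_badCut_of_pairOutEdges (by omega) hsa hsb hab hf
        fun v _ h => avoids_inEdges.1 hf'.2 v h
    · exact mem_badCut_of_pairInEdges (by omega) hsa hsb hab hf hf'.1
  have v1 : PrGnm n m (A ∪ B ∪ C ∪ badCut n 3 ∪ nearIsolated n) ≤ _ := prWeight_union_le hw _ _
  have v2 : PrGnm n m (A ∪ B ∪ C ∪ badCut n 3) ≤ _ := prWeight_union_le hw _ _
  have v3 : PrGnm n m (A ∪ B ∪ C) + PrGnm n m ((A ∪ B) ∩ C) = _ := prWeight_union_add_inter _ _ _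
  have v4 : PrGnm n m (A ∪ B) + PrGnm n m (A ∩ B) = _ := prWeight_union_add_inter _ _ _
  have v5 := PrGnm_nonneg n m (A ∩ B)
  have v6 := PrGnm_nonneg n m ((A ∪ B) ∩ C)
  have v7 := PrGnm_nonneg n m (badCut n 3)
  have v8 := PrGnm_nonneg n m (nearIsolated n)
  simp only [PrGnm] at *
  constructor <;> linarith

end Bounds

section Recursion

open Polynomial in
lemma oriCount_succ_left (a k m : ℕ) :
    oriCount (a + 1) k (m + 1) = oriCount a k (m + 1) + 2 * oriCount a k m := by
  have : ((1 + 2 * X) ^ (a + 1) * (1 + X) ^ k : ℝ[X]) =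
      (1 + 2 * X) ^ a * (1 + X) ^ k + C 2 * (((1 + 2 * X) ^ a * (1 + X) ^ k) * X) := by
    rw [show (C 2 : ℝ[X]) = 2 from rfl]
    ring
  rw [oriCount, this, coeff_add, coeff_C_mul, coeff_mul_X, oriCount, oriCount]

open Polynomial in
lemma oriCount_succ_right (a k m : ℕ) :
    oriCount a (k + 1) (m + 1) = oriCount a k (m + 1) + oriCount a k m := by
  have : ((1 + 2 * X) ^ a * (1 + X) ^ (k + 1) : ℝ[X]) =
      (1 + 2 * X) ^ a * (1 + X) ^ k + ((1 + 2 * X) ^ a * (1 + X) ^ k) * X := by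
    ring
  rw [oriCount, this, coeff_add, coeff_mul_X, oriCount, oriCount]

open Polynomial in
lemma oriCount_edge_sum (a k m : ℕ) :
    (m + 1) * oriCount a k (m + 1) =
      2 * a * oriCount (a - 1) k m + k * oriCount a (k - 1) m := by
  have h := coeff_derivative ((1 + 2 * X) ^ a * (1 + X) ^ k : ℝ[X]) m
  have h2 : derivative ((1 + 2 * X) ^ a * (1 + X) ^ k : ℝ[X]) =
      C (2 * a : ℝ) * ((1 + 2 * X) ^ (a - 1) * (1 + X) ^ k) +
        C (k : ℝ) * ((1 + 2 * X) ^ a * (1 + X) ^ (k - 1)) := by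
    rw [show (2 : ℝ[X]) = C 2 from rfl]
    simp only [derivative_mul, derivative_pow, derivative_add, derivative_one, derivative_X,
      derivative_C, C_mul]
    ring
  rw [h2, coeff_add, coeff_C_mul, coeff_C_mul] at h
  rw [oriCount, oriCount, oriCount, h]
  ring

lemma choose_le_oriCount (a k m : ℕ) : ((a + k).choose m : ℝ) ≤ oriCount a k m := by
  induction a generalizing m with
  | zero =>
    rw [oriCount, pow_zero, one_mul, Polynomial.coeff_one_add_X_pow, zero_add]
  | succ a ih =>
    cases m with
    | zero => simp [oriCount, Polynomial.coeff_zero_eq_eval_zero]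
    | succ m =>
      have h1 := ih m
      have h2 := ih (m + 1)
      have h3 : (0 : ℝ) ≤ ((a + k).choose m : ℝ) := by positivity
      rw [oriCount_succ_left, show a + 1 + k = (a + k) + 1 by ring, Nat.choose_succ_succ]
      push_cast
      linarith

lemma oriCount_nonneg (a k m : ℕ) : 0 ≤ oriCount a k m :=
  le_trans (by positivity) (choose_le_oriCount a k m)

lemma oriCount_pos {a k m : ℕ} (h : m ≤ a + k) : 0 < oriCount a k m :=
  lt_of_lt_of_le (by exact_mod_cast Nat.choose_pos h) (choose_le_oriCount a k m)

/-- The conditional probability in `G(n,m)`, where `N` is the number of pairs of vertices, that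
an edge is present, given that `k` directed edges between other pairs are absent. -/
noncomputable def edgeProb (N m k : ℕ) : ℝ :=
  2 * oriCount (N - (k + 1)) k (m - 1) / oriCount (N - k) k m

variable {N m k : ℕ}

lemma oriCount_split (hm : 1 ≤ m) (hk : k < N) :
    oriCount (N - k) k m =
      oriCount (N - (k + 1)) k m + 2 * oriCount (N - (k + 1)) k (m - 1) := by
  obtain ⟨m, rfl⟩ := Nat.exists_eq_add_of_le' hm
  rw [show N - k = N - (k + 1) + 1 by omega, oriCount_succ_left]
  rfl

lemma edgeProb_mem (hm : 1 ≤ m) (hk : k < N) (hmN : m ≤ N) :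
    edgeProb N m k ∈ Set.Icc (0 : ℝ) 1 := by
  have hpos : 0 < oriCount (N - k) k m := oriCount_pos (by omega)
  have h1 := oriCount_nonneg (N - (k + 1)) k (m - 1)
  refine ⟨by unfold edgeProb; positivity, ?_⟩
  rw [edgeProb, div_le_one hpos, oriCount_split hm hk]
  linarith [oriCount_nonneg (N - (k + 1)) k m]

lemma edgeProb_zero (hm : 1 ≤ m) (hmN : m ≤ N) : edgeProb N m 0 = m / N := by
  have hpos : 0 < oriCount N 0 m := oriCount_pos (by omega)
  have hN : (0 : ℝ) < N := by exact_mod_cast (by omega : 0 < N)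
  obtain ⟨m, rfl⟩ := Nat.exists_eq_add_of_le' hm
  have := oriCount_edge_sum N 0 m
  rw [edgeProb, zero_add, Nat.sub_zero, Nat.add_sub_cancel, div_eq_div_iff hpos.ne' hN.ne']
  push_cast at this ⊢
  linarith

lemma avoidProb_succ (hm : 1 ≤ m) (hk : k < N) (hmN : m ≤ N) :
    avoidProb N m (k + 1) = avoidProb N m k * (1 - edgeProb N m k / 2) := by
  have hpos : 0 < oriCount (N - k) k m := oriCount_pos (by omega)
  have hpos0 : 0 < oriCount N 0 m := oriCount_pos (by omega)
  have h1 := oriCount_split hm hk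
  have h2 : oriCount (N - (k + 1)) (k + 1) m =
      oriCount (N - (k + 1)) k m + oriCount (N - (k + 1)) k (m - 1) := by
    obtain ⟨m, rfl⟩ := Nat.exists_eq_add_of_le' hm
    exact oriCount_succ_right _ _ _
  rw [avoidProb, avoidProb, edgeProb, h2]
  field_simp
  rw [h1]
  ring

lemma avoidProb_eq_prod (hm : 1 ≤ m) (hk : k ≤ N) (hmN : m ≤ N) :
    avoidProb N m k = ∏ i ∈ Finset.range k, (1 - edgeProb N m i / 2) := by
  induction k with
  | zero =>
    rw [avoidProb, Finset.prod_range_zero, Nat.sub_zero, div_self (oriCount_pos (by omega)).ne']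
  | succ k ih => rw [avoidProb_succ hm hk hmN, ih (by omega), Finset.prod_range_succ]

lemma edgeProb_succ (hm : 1 ≤ m) (hk : k + 1 < N) (hmN : m ≤ N) :
    (N - (k + 1 : ℕ)) * edgeProb N m (k + 1) =
      m - (k + 1 : ℕ) * (edgeProb N m k / (2 - edgeProb N m k)) := by
  have hpos : 0 < oriCount (N - k) k m := oriCount_pos (by omega)
  have hpos1 : 0 < oriCount (N - (k + 1)) (k + 1) m := oriCount_pos (by omega)
  have h1 := oriCount_split hm (by omega : k < N)
  have h2 : oriCount (N - (k + 1)) (k + 1) m =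
      oriCount (N - (k + 1)) k m + oriCount (N - (k + 1)) k (m - 1) := by
    obtain ⟨m, rfl⟩ := Nat.exists_eq_add_of_le' hm
    exact oriCount_succ_right _ _ _
  have h3 : m * oriCount (N - (k + 1)) (k + 1) m =
      2 * (N - (k + 1 : ℕ)) * oriCount (N - (k + 1 + 1)) (k + 1) (m - 1) +
        (k + 1 : ℕ) * oriCount (N - (k + 1)) k (m - 1) := by
    obtain ⟨m, rfl⟩ := Nat.exists_eq_add_of_le' hm
    have := oriCount_edge_sum (N - (k + 1)) (k + 1) m
    rw [Nat.cast_sub hk.le] at this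
    rw [Nat.add_sub_cancel, Nat.cast_add, Nat.cast_one (R := ℝ), this]
    rfl
  have h4 : edgeProb N m k / (2 - edgeProb N m k) =
      oriCount (N - (k + 1)) k (m - 1) / oriCount (N - (k + 1)) (k + 1) m := by
    have h5 : 2 - edgeProb N m k =
        2 * oriCount (N - (k + 1)) (k + 1) m / oriCount (N - k) k m := by
      rw [edgeProb, h2, eq_div_iff hpos.ne', sub_mul, div_mul_cancel₀ _ hpos.ne', h1]
      ring
    rw [h5, edgeProb]
    field_simp
  rw [h4, edgeProb]
  field_simp
  linarith

lemma abs_edgeProb_sub_le (hm : 1 ≤ m) (hk : k < N) (hmN : m ≤ N) :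
    |edgeProb N m k - m / N| ≤ k / (N - k) := by
  have hN : (0 : ℝ) < N := by exact_mod_cast (by omega : 0 < N)
  have hP0 : (0 : ℝ) ≤ m / N := by positivity
  have hP1 : (m / N : ℝ) ≤ 1 := by rw [div_le_one hN]; exact_mod_cast hmN
  cases k with
  | zero => simp [edgeProb_zero hm hmN]
  | succ k =>
    have hd : (0 : ℝ) < N - (k + 1 : ℕ) := by
      rw [sub_pos]; exact_mod_cast hk
    have h := edgeProb_succ hm hk hmN
    have hv := edgeProb_mem hm (by omega : k < N) hmN
    have h2 : (0 : ℝ) < 2 - edgeProb N m k := by linarith [hv.2]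
    have hh0 : 0 ≤ edgeProb N m k / (2 - edgeProb N m k) := div_nonneg hv.1 h2.le
    have hh1 : edgeProb N m k / (2 - edgeProb N m k) ≤ 1 := by
      rw [div_le_one h2]; linarith [hv.2]
    have e : edgeProb N m (k + 1) - m / N =
        (k + 1 : ℕ) / (N - (k + 1 : ℕ)) * (m / N - edgeProb N m k / (2 - edgeProb N m k)) := by
      generalize edgeProb N m k / (2 - edgeProb N m k) = z at *
      rw [← mul_right_inj' hd.ne', mul_sub, h, div_mul_eq_mul_div, mul_div_cancel₀ _ hd.ne']
      field_simp
      ring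
    rw [e, abs_mul, abs_of_nonneg (div_nonneg (Nat.cast_nonneg _) hd.le)]
    refine mul_le_of_le_one_right (div_nonneg (Nat.cast_nonneg _) hd.le) ?_
    rw [abs_le]
    constructor <;> linarith

lemma abs_edgeProb_sub_sub_le (hm : 1 ≤ m) (hk : k < N) (hmN : m ≤ N) :
    |edgeProb N m k - m / N - k / (N - k) * (m / N - m / N / (2 - m / N))| ≤
      2 * (k / (N - k)) ^ 2 := by
  have hN : (0 : ℝ) < N := by exact_mod_cast (by omega : 0 < N)
  have hP0 : (0 : ℝ) ≤ m / N := by positivity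
  have hP1 : (m / N : ℝ) ≤ 1 := by rw [div_le_one hN]; exact_mod_cast hmN
  cases k with
  | zero => simp [edgeProb_zero hm hmN]
  | succ k =>
    have hd : (0 : ℝ) < N - (k + 1 : ℕ) := by
      rw [sub_pos]; exact_mod_cast hk
    have h := edgeProb_succ hm hk hmN
    have hv := edgeProb_mem hm (by omega : k < N) hmN
    have h2 : (0 : ℝ) < 2 - edgeProb N m k := by linarith [hv.2]
    have hκ := abs_edgeProb_sub_le hm (by omega : k < N) hmN
    have hκ2 : (k : ℝ) / (N - k) ≤ (k + 1 : ℕ) / (N - (k + 1 : ℕ)) := by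
      refine div_le_div₀ (Nat.cast_nonneg _) ?_ hd ?_ <;> push_cast <;> linarith
    have hh : |m / N / (2 - m / N) - edgeProb N m k / (2 - edgeProb N m k)| ≤
        2 * |edgeProb N m k - m / N| := by
      have e : m / N / (2 - m / N) - edgeProb N m k / (2 - edgeProb N m k) =
          2 * (m / N - edgeProb N m k) / ((2 - m / N) * (2 - edgeProb N m k)) := by
        have h3 : (2 - m / N : ℝ) ≠ 0 := by linarith
        rw [div_sub_div _ _ h3 h2.ne']
        ring
      have h4 : 1 ≤ (2 - m / N) * (2 - edgeProb N m k) := by nlinarith [hv.2]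
      rw [e, abs_div, abs_mul, abs_of_nonneg (by linarith : 0 ≤ (2 - m / N) * (2 - edgeProb N m k)),
        abs_two, abs_sub_comm]
      exact div_le_self (by positivity) h4
    have e : edgeProb N m (k + 1) - m / N -
        (k + 1 : ℕ) / (N - (k + 1 : ℕ)) * (m / N - m / N / (2 - m / N)) =
        (k + 1 : ℕ) / (N - (k + 1 : ℕ)) *
          (m / N / (2 - m / N) - edgeProb N m k / (2 - edgeProb N m k)) := by
      generalize edgeProb N m k / (2 - edgeProb N m k) = z at *
      generalize (m / N / (2 - m / N) : ℝ) = y at *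
      rw [← mul_right_inj' hd.ne', mul_sub, mul_sub, h]
      field_simp
      ring
    have hκ0 : (0 : ℝ) ≤ (k + 1 : ℕ) / (N - (k + 1 : ℕ)) := div_nonneg (Nat.cast_nonneg _) hd.le
    rw [e, abs_mul, abs_of_nonneg hκ0, sq, mul_left_comm]
    refine mul_le_mul_of_nonneg_left ?_ hκ0
    linarith

end Recursion

section Limits

open Filter Topology

lemma tendsto_sum_range_of_mul {f : ℕ → ℕ → ℝ} {t : ℝ}
    (h : ∀ i : ℕ → ℕ, (∀ n, i n ≤ n) →
      Tendsto (fun n : ℕ => (n + 1 : ℝ) * f n (i n)) atTop (𝓝 t)) :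
    Tendsto (fun n => ∑ i ∈ Finset.range (n + 1), f n i) atTop (𝓝 t) := by
  have hmax : ∀ n, ∃ j ∈ Finset.range (n + 1), ∀ i ∈ Finset.range (n + 1), f n i ≤ f n j :=
    fun n => Finset.exists_max_image _ _ ⟨0, by simp⟩
  have hmin : ∀ n, ∃ j ∈ Finset.range (n + 1), ∀ i ∈ Finset.range (n + 1), f n j ≤ f n i :=
    fun n => Finset.exists_min_image _ _ ⟨0, by simp⟩
  choose u hu hu' using hmax
  choose l hl hl' using hmin
  refine tendsto_of_tendsto_of_tendsto_of_le_of_le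
    (h l fun n => Nat.lt_succ_iff.1 (Finset.mem_range.1 (hl n)))
    (h u fun n => Nat.lt_succ_iff.1 (Finset.mem_range.1 (hu n))) (fun n => ?_) fun n => ?_
  · have := Finset.card_nsmul_le_sum _ (f n) _ (hl' n)
    simpa using this
  · have := Finset.sum_le_card_nsmul _ (f n) _ (hu' n)
    simpa using this

lemma tendsto_prod_div {x y : ℕ → ℕ → ℝ} {q t : ℝ} (hq : 0 < q)
    (hpos : ∀ᶠ n in atTop, ∀ i ≤ n, 0 < x n i ∧ 0 < y n i)
    (hx : ∀ i : ℕ → ℕ, (∀ n, i n ≤ n) → Tendsto (fun n => x n (i n)) atTop (𝓝 q))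
    (hy : ∀ i : ℕ → ℕ, (∀ n, i n ≤ n) → Tendsto (fun n => y n (i n)) atTop (𝓝 q))
    (hxy : ∀ i : ℕ → ℕ, (∀ n, i n ≤ n) →
      Tendsto (fun n : ℕ => (n + 1 : ℝ) * (y n (i n) - x n (i n))) atTop (𝓝 t)) :
    Tendsto (fun n => ∏ i ∈ Finset.range (n + 1), y n i / x n i) atTop (𝓝 (exp (t / q))) := by
  have hupper : Tendsto (fun n => exp (∑ i ∈ Finset.range (n + 1), (y n i - x n i) / x n i))
      atTop (𝓝 (exp (t / q))) := by
    refine (continuous_exp.tendsto _).comp (tendsto_sum_range_of_mul fun i hi => ?_)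
    exact ((hxy i hi).div (hx i hi) hq.ne').congr fun n => mul_div_assoc _ _ _
  have hlower : Tendsto (fun n => exp (∑ i ∈ Finset.range (n + 1), (y n i - x n i) / y n i))
      atTop (𝓝 (exp (t / q))) := by
    refine (continuous_exp.tendsto _).comp (tendsto_sum_range_of_mul fun i hi => ?_)
    exact ((hxy i hi).div (hy i hi) hq.ne').congr fun n => mul_div_assoc _ _ _
  refine tendsto_of_tendsto_of_tendsto_of_le_of_le' hlower hupper ?_ ?_
  · filter_upwards [hpos] with n hn
    rw [exp_sum]
    refine Finset.prod_le_prod (fun i _ => (exp_pos _).le) fun i hi => ?_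
    obtain ⟨h1, h2⟩ := hn i (Nat.lt_succ_iff.1 (Finset.mem_range.1 hi))
    have h3 := add_one_le_exp (-((y n i - x n i) / y n i))
    have h4 : -((y n i - x n i) / y n i) + 1 = x n i / y n i := by field_simp; ring
    rw [h4, exp_neg, ← inv_div] at h3
    exact (inv_le_inv₀ (div_pos h2 h1) (exp_pos _)).1 h3
  · filter_upwards [hpos] with n hn
    rw [exp_sum]
    refine Finset.prod_le_prod (fun i hi => ?_) fun i hi => ?_ <;>
      obtain ⟨h1, h2⟩ := hn i (Nat.lt_succ_iff.1 (Finset.mem_range.1 hi))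
    · exact (div_pos h2 h1).le
    · have h3 := add_one_le_exp ((y n i - x n i) / x n i)
      have h4 : (y n i - x n i) / x n i + 1 = y n i / x n i := by field_simp; ring
      rwa [h4] at h3

lemma tendsto_zero_of_le_pow_mul {A : ℕ → ℝ} {C x : ℝ} (hx0 : 0 ≤ x) (hx1 : x < 1)
    (h0 : ∀ᶠ n in atTop, 0 ≤ A n) (h : ∀ᶠ n : ℕ in atTop, A n ≤ C * ((n : ℝ) ^ 7 * x ^ n)) :
    Tendsto A atTop (𝓝 0) := by
  refine tendsto_of_tendsto_of_tendsto_of_le_of_le' tendsto_const_nhds ?_ h0 h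
  simpa using (tendsto_pow_const_mul_const_pow_of_abs_lt_one 7
    (by rwa [abs_of_nonneg hx0])).const_mul C

lemma cast_choose_two_add_three (n : ℕ) :
    ((n + 3).choose 2 : ℝ) = (n + 3) * (n + 2) / 2 := by
  rw [Nat.cast_choose_two]
  push_cast
  ring

lemma lt_choose_two {n i : ℕ} (hn : 3 ≤ n) (hi : i ≤ 2 * n + 3) : i < (n + 3).choose 2 := by
  have h : ((2 * n + 3 : ℕ) : ℝ) < ((n + 3).choose 2 : ℝ) := by
    have h1 : (3 : ℝ) ≤ n := by exact_mod_cast hn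
    rw [cast_choose_two_add_three]
    push_cast
    nlinarith
  exact lt_of_le_of_lt hi (by exact_mod_cast h)

lemma div_choose_two_sub_le {n i : ℕ} (hn : 3 ≤ n) (hi : i ≤ 2 * n + 3) :
    (i : ℝ) / ((n + 3).choose 2 - i) ≤ 6 / (n + 1) := by
  have h1 : (3 : ℝ) ≤ n := by exact_mod_cast hn
  have h2 : (i : ℝ) ≤ 2 * n + 3 := by exact_mod_cast hi
  rw [cast_choose_two_add_three, div_le_div_iff₀ (by nlinarith) (by linarith)]
  nlinarith

lemma abs_sub_div_two_sub_le_one {x : ℝ} (h0 : 0 ≤ x) (h1 : x ≤ 1) : |x - x / (2 - x)| ≤ 1 := by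
  have h2 : 0 ≤ x / (2 - x) := div_nonneg h0 (by linarith)
  have h3 : x / (2 - x) ≤ 1 := by rw [div_le_one] <;> linarith
  rw [abs_le]
  constructor <;> linarith

lemma abs_edgeProb_sub_linear_le {n m i : ℕ} (hn : 3 ≤ n) (hi : i ≤ 2 * n + 3) (hm : 1 ≤ m)
    (hmN : m ≤ (n + 3).choose 2) :
    |edgeProb ((n + 3).choose 2) m i - m / (n + 3).choose 2 - i / (n + 3).choose 2 *
      (m / (n + 3).choose 2 - m / (n + 3).choose 2 / (2 - m / (n + 3).choose 2))| ≤
      108 / (n + 1) ^ 2 := by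
  have hiN := lt_choose_two hn hi
  have h := abs_edgeProb_sub_sub_le hm hiN hmN
  have hκ := div_choose_two_sub_le hn hi
  generalize (n + 3).choose 2 = N at *
  have hN : (0 : ℝ) < N := by exact_mod_cast (by omega : 0 < N)
  have hd : (0 : ℝ) < N - i := by rw [sub_pos]; exact_mod_cast hiN
  have hD := abs_sub_div_two_sub_le_one (x := m / N) (by positivity)
    (by rw [div_le_one hN]; exact_mod_cast hmN)
  generalize (m / N - m / N / (2 - m / N) : ℝ) = D at *
  have hκ0 : (0 : ℝ) ≤ i / (N - i) := by positivity
  have e : edgeProb N m i - m / N - i / N * D =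
      (edgeProb N m i - m / N - i / (N - i) * D) + i / N * (i / (N - i)) * D := by
    field_simp
    ring
  have h1 : (i : ℝ) / N ≤ i / (N - i) := by
    refine div_le_div_of_nonneg_left (by positivity) hd ?_
    linarith [(Nat.cast_nonneg i : (0 : ℝ) ≤ i)]
  have h2 : |i / N * (i / (N - i)) * D| ≤ (i / (N - i)) ^ 2 := by
    rw [abs_mul, abs_of_nonneg (by positivity), sq]
    exact (mul_le_of_le_one_right (by positivity) hD).trans
      (mul_le_mul_of_nonneg_right h1 hκ0)
  have h3 : ((i : ℝ) / (N - i)) ^ 2 ≤ (6 / (n + 1)) ^ 2 := pow_le_pow_left₀ hκ0 hκ 2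
  rw [e]
  refine (abs_add_le _ _).trans ?_
  calc _ ≤ 3 * (6 / (n + 1) : ℝ) ^ 2 := by linarith
    _ = _ := by rw [div_pow]; ring

variable {m : ℕ → ℕ} {p : ℝ}

lemma tendsto_edgeProb (hm1 : ∀ᶠ n in atTop, 1 ≤ m n) (hmN : ∀ n, m n ≤ (n + 3).choose 2)
    (hmp : Tendsto (fun n : ℕ => (m n : ℝ) / ((n + 3).choose 2 : ℝ)) atTop (𝓝 p))
    {i : ℕ → ℕ} (hi : ∀ n, i n ≤ 2 * n + 3) :
    Tendsto (fun n => edgeProb ((n + 3).choose 2) (m n) (i n)) atTop (𝓝 p) := by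
  have h6 : Tendsto (fun n : ℕ => (6 : ℝ) / (n + 1)) atTop (𝓝 0) := by
    simpa [div_eq_mul_inv] using (tendsto_one_div_add_atTop_nhds_zero_nat (𝕜 := ℝ)).const_mul 6
  have h : Tendsto (fun n => edgeProb ((n + 3).choose 2) (m n) (i n) -
      (m n : ℝ) / ((n + 3).choose 2 : ℝ)) atTop (𝓝 0) := by
    refine squeeze_zero_norm' ?_ h6
    filter_upwards [hm1, eventually_ge_atTop 3] with n h1 h3
    exact (abs_edgeProb_sub_le h1 (lt_choose_two h3 (hi n)) (hmN n)).trans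
      (div_choose_two_sub_le h3 (hi n))
  simpa using h.add hmp

lemma tendsto_mul_edgeProb_sub (hp : p ≤ 1) (hm1 : ∀ᶠ n in atTop, 1 ≤ m n)
    (hmN : ∀ n, m n ≤ (n + 3).choose 2)
    (hmp : Tendsto (fun n : ℕ => (m n : ℝ) / ((n + 3).choose 2 : ℝ)) atTop (𝓝 p))
    {i : ℕ → ℕ} (hi : ∀ n, i n ≤ n) :
    Tendsto (fun n : ℕ => (n + 1 : ℝ) * (edgeProb ((n + 3).choose 2) (m n) (n + 2 + i n) -
      edgeProb ((n + 3).choose 2) (m n) (i n))) atTop (𝓝 (2 * (p - p / (2 - p)))) := by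
  have hinv := tendsto_one_div_add_atTop_nhds_zero_nat (𝕜 := ℝ)
  have h216 : Tendsto (fun n : ℕ => (216 : ℝ) / (n + 1)) atTop (𝓝 0) := by
    simpa [div_eq_mul_inv] using hinv.const_mul 216
  have hc : Tendsto (fun n : ℕ => (n + 1 : ℝ) * ((n + 2) / (n + 3).choose 2)) atTop (𝓝 2) := by
    have h : Tendsto (fun n : ℕ => 2 / (1 + 2 * (1 / ((n : ℝ) + 1)))) atTop (𝓝 2) := by
      have h := (tendsto_const_nhds (x := (2 : ℝ))).div ((hinv.const_mul 2).const_add 1)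
        (by norm_num)
      rwa [mul_zero, add_zero, div_one] at h
    refine h.congr fun n => ?_
    rw [cast_choose_two_add_three]
    field_simp
    ring
  have hmain := hc.mul (hmp.sub (hmp.div (hmp.const_sub 2) (by linarith : 2 - p ≠ 0)))
  have herr : Tendsto (fun n : ℕ => (n + 1 : ℝ) * (edgeProb ((n + 3).choose 2) (m n) (n + 2 + i n) -
      edgeProb ((n + 3).choose 2) (m n) (i n)) - (n + 1 : ℝ) * ((n + 2) / (n + 3).choose 2) *
      (m n / (n + 3).choose 2 - m n / (n + 3).choose 2 / (2 - m n / (n + 3).choose 2)))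
      atTop (𝓝 0) := by
    refine squeeze_zero_norm' ?_ h216
    filter_upwards [hm1, eventually_ge_atTop 3] with n h1 h3
    have ha := abs_edgeProb_sub_linear_le (i := n + 2 + i n) h3 (by linarith [hi n]) h1 (hmN n)
    have hb := abs_edgeProb_sub_linear_le (i := i n) h3 (by linarith [hi n]) h1 (hmN n)
    generalize (m n / (n + 3).choose 2 - m n / (n + 3).choose 2 /
      (2 - m n / (n + 3).choose 2) : ℝ) = D at *
    push_cast at ha
    rw [norm_eq_abs]
    have hn : (0 : ℝ) < n + 1 := by positivity
    calc _ = (n + 1 : ℝ) * |(edgeProb ((n + 3).choose 2) (m n) (n + 2 + i n) -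
          m n / (n + 3).choose 2 - (n + 2 + i n) / (n + 3).choose 2 * D) -
          (edgeProb ((n + 3).choose 2) (m n) (i n) - m n / (n + 3).choose 2 -
            i n / (n + 3).choose 2 * D)| := by
          rw [← abs_of_pos hn, ← abs_mul, abs_of_pos hn]
          congr 1
          ring
      _ ≤ (n + 1 : ℝ) * (108 / (n + 1) ^ 2 + 108 / (n + 1) ^ 2) := by
          refine mul_le_mul_of_nonneg_left ((abs_sub _ _).trans (add_le_add ha hb)) hn.le
      _ = _ := by
          field_simp
          norm_num
  simpa using herr.add hmain

lemma tendsto_avoidProb_div_sq (hp : p ≤ 1) (hm1 : ∀ᶠ n in atTop, 1 ≤ m n)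
    (hmN : ∀ n, m n ≤ (n + 3).choose 2)
    (hmp : Tendsto (fun n : ℕ => (m n : ℝ) / ((n + 3).choose 2 : ℝ)) atTop (𝓝 p)) :
    Tendsto (fun n => avoidProb ((n + 3).choose 2) (m n) (2 * n + 3) /
      avoidProb ((n + 3).choose 2) (m n) (n + 2) ^ 2) atTop
      (𝓝 (exp (-(2 * p * (1 - p)) / (2 - p) ^ 2) / (1 - p / 2))) := by
  have hq : 0 < 1 - p / 2 := by linarith
  have hpos : ∀ᶠ n in atTop, ∀ i ≤ 2 * n + 3,
      0 < 1 - edgeProb ((n + 3).choose 2) (m n) i / 2 := by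
    filter_upwards [hm1, eventually_ge_atTop 3] with n h1 h3 i hi
    linarith [(edgeProb_mem h1 (lt_choose_two h3 hi) (hmN n)).2]
  have hlim : ∀ i : ℕ → ℕ, (∀ n, i n ≤ 2 * n + 3) →
      Tendsto (fun n => 1 - edgeProb ((n + 3).choose 2) (m n) (i n) / 2) atTop
        (𝓝 (1 - p / 2)) :=
    fun i hi => ((tendsto_edgeProb hm1 hmN hmp hi).div_const 2).const_sub 1
  have hprod : Tendsto (fun n => ∏ i ∈ Finset.range (n + 1),
      (1 - edgeProb ((n + 3).choose 2) (m n) (n + 2 + i) / 2) /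
        (1 - edgeProb ((n + 3).choose 2) (m n) i / 2)) atTop
      (𝓝 (exp (-(2 * p * (1 - p)) / (2 - p) ^ 2))) := by
    have e : -(2 * p * (1 - p)) / (2 - p) ^ 2 =
        -1 / 2 * (2 * (p - p / (2 - p))) / (1 - p / 2) := by
      have h1 : 2 - p ≠ 0 := by linarith
      have h2 : 1 - p / 2 = (2 - p) / 2 := by ring
      rw [h2]
      field_simp
      ring
    rw [e]
    refine tendsto_prod_div hq ?_ (fun i hi => hlim i fun n => by linarith [hi n])
      (fun i hi => hlim (fun n => n + 2 + i n) fun n => by linarith [hi n]) fun i hi => ?_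
    · filter_upwards [hpos] with n hn i hi
      exact ⟨hn i (by omega), hn _ (by omega)⟩
    · refine ((tendsto_mul_edgeProb_sub hp hm1 hmN hmp hi).const_mul (-1 / 2)).congr fun n => ?_
      ring
  refine (hprod.div (hlim (fun n => n + 1) fun n => by omega) hq.ne').congr' ?_
  filter_upwards [hm1, hpos, eventually_ge_atTop 3] with n h1 hn h3
  rw [Pi.div_apply, avoidProb_eq_prod h1 (lt_choose_two h3 le_rfl).le (hmN n),
    avoidProb_eq_prod h1 (lt_choose_two h3 (by omega)).le (hmN n),
    show 2 * n + 3 = (n + 2) + (n + 1) by ring, Finset.prod_range_add _ (n + 2),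
    Finset.prod_div_distrib, Finset.prod_range_succ _ (n + 1)]
  have h4 : 0 < ∏ i ∈ Finset.range (n + 1), (1 - edgeProb ((n + 3).choose 2) (m n) i / 2) :=
    Finset.prod_pos fun i hi => hn i (by rw [Finset.mem_range] at hi; omega)
  have h5 := hn (n + 1) (by omega)
  generalize ∏ i ∈ Finset.range (n + 1), (1 - edgeProb ((n + 3).choose 2) (m n) i / 2) = x at *
  generalize 1 - edgeProb ((n + 3).choose 2) (m n) (n + 1) / 2 = y at *
  field_simp

end Limits

section Errors

open Filter Topology

variable {m : ℕ → ℕ} {p : ℝ}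

lemma exists_decay_rates (hp0 : 0 < p) (hp1 : p ≤ 1) :
    ∃ x y z : ℝ, 0 < x ∧ x < 1 - p / 2 ∧ 1 - p / 2 < y ∧ y < 1 ∧ 1 - p < z ∧
      y ^ 2 < x ∧ y ^ 3 < x ^ 2 ∧ z < x ^ 2 := by
  have hq : 0 < 1 - p / 2 := by linarith
  have hq1 : 1 - p / 2 < 1 := by linarith
  have key : ∀ {f g : ℝ → ℝ}, Continuous f → Continuous g → f 0 < g 0 →
      ∀ᶠ ε in 𝓝[>] (0 : ℝ), f ε < g ε := fun hf hg h =>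
    ((hf.tendsto 0).eventually_lt (hg.tendsto 0) h).filter_mono nhdsWithin_le_nhds
  have h1 : ∀ᶠ ε in 𝓝[>] (0 : ℝ), 0 < 1 - p / 2 - ε :=
    key (by fun_prop) (by fun_prop) (by linarith)
  have h2 : ∀ᶠ ε in 𝓝[>] (0 : ℝ), 1 - p / 2 + ε < 1 :=
    key (by fun_prop) (by fun_prop) (by linarith)
  have h3 : ∀ᶠ ε in 𝓝[>] (0 : ℝ), (1 - p / 2 + ε) ^ 2 < 1 - p / 2 - ε :=
    key (by fun_prop) (by fun_prop) (by nlinarith)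
  have h4 : ∀ᶠ ε in 𝓝[>] (0 : ℝ), (1 - p / 2 + ε) ^ 3 < (1 - p / 2 - ε) ^ 2 :=
    key (by fun_prop) (by fun_prop) (by nlinarith [pow_pos hq 2])
  have h5 : ∀ᶠ ε in 𝓝[>] (0 : ℝ), 1 - p + ε < (1 - p / 2 - ε) ^ 2 :=
    key (by fun_prop) (by fun_prop) (by nlinarith)
  obtain ⟨ε, h1, h2, h3, h4, h5, h0⟩ :=
    (h1.and <| h2.and <| h3.and <| h4.and <| h5.and self_mem_nhdsWithin).exists
  have h0 : 0 < ε := h0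
  exact ⟨_, _, _, h1, by linarith, by linarith, h2, by linarith, h3, h4, h5⟩

lemma pow_le_avoidProb_of_forall_le {N m k : ℕ} {x : ℝ} (hm : 1 ≤ m) (hk : k ≤ N) (hmN : m ≤ N)
    (hx : 0 ≤ x) (h : ∀ i < k, x ≤ 1 - edgeProb N m i / 2) : x ^ k ≤ avoidProb N m k := by
  rw [avoidProb_eq_prod hm hk hmN]
  calc x ^ k = ∏ _i ∈ Finset.range k, x := by rw [Finset.prod_const, Finset.card_range]
    _ ≤ _ := Finset.prod_le_prod (fun _ _ => hx) fun i hi => h i (Finset.mem_range.1 hi)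

lemma eventually_pow_le_avoidProb (hm1 : ∀ᶠ n in atTop, 1 ≤ m n)
    (hmN : ∀ n, m n ≤ (n + 3).choose 2)
    (hmp : Tendsto (fun n : ℕ => (m n : ℝ) / ((n + 3).choose 2 : ℝ)) atTop (𝓝 p))
    {x : ℝ} (hx0 : 0 ≤ x) (hx : x < 1 - p / 2) :
    ∀ᶠ n in atTop, ∀ k ≤ 2 * n + 3, x ^ k ≤ avoidProb ((n + 3).choose 2) (m n) k := by
  have h6 : Tendsto (fun n : ℕ => (6 : ℝ) / (n + 1)) atTop (𝓝 0) := by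
    simpa [div_eq_mul_inv] using (tendsto_one_div_add_atTop_nhds_zero_nat (𝕜 := ℝ)).const_mul 6
  have hlim := ((hmp.add h6).div_const 2).const_sub 1
  rw [add_zero] at hlim
  filter_upwards [hm1, eventually_ge_atTop 3, hlim.eventually (lt_mem_nhds hx)] with n h1 h3 hn k hk
  refine pow_le_avoidProb_of_forall_le h1 (lt_choose_two h3 hk).le (hmN n) hx0 fun i hi => ?_
  have h := (abs_edgeProb_sub_le h1 (lt_choose_two h3 (by omega : i ≤ 2 * n + 3)) (hmN n)).trans
    (div_choose_two_sub_le h3 (by omega))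
  linarith [(abs_le.1 h).2]

lemma eventually_mul_pow_le_one {y : ℝ} (hy0 : 0 ≤ y) (hy1 : y < 1) {t : ℕ} :
    ∀ᶠ n : ℕ in atTop, 2 * (n + 3 : ℝ) * y ^ ((n + 3) / 2 - t) ≤ 1 := by
  have h1 : Tendsto (fun k : ℕ => 4 * ((k : ℝ) * y ^ k) + (4 * t + 2) * y ^ k) atTop (𝓝 0) := by
    have hy : |y| < 1 := by rwa [abs_of_nonneg hy0]
    simpa using ((tendsto_self_mul_const_pow_of_abs_lt_one hy).const_mul 4).add
      ((tendsto_pow_atTop_nhds_zero_of_lt_one hy0 hy1).const_mul (4 * t + 2 : ℝ))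
  have h2 : Tendsto (fun n : ℕ => (n + 3) / 2 - t) atTop atTop :=
    tendsto_atTop.2 fun b => eventually_atTop.2 ⟨2 * (b + t), fun n hn => by omega⟩
  filter_upwards [(h1.comp h2).eventually (gt_mem_nhds one_pos), eventually_ge_atTop (2 * t)]
    with n hn ht
  rw [Function.comp_apply] at hn
  set k := (n + 3) / 2 - t with hk
  have h3 : (n + 3 : ℝ) ≤ 2 * k + 2 * t + 1 := by
    have : n + 3 ≤ 2 * k + 2 * t + 1 := by omega
    exact_mod_cast this
  have h4 : 0 ≤ y ^ k := by positivity
  nlinarith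

lemma choose_two_add_one_le {n : ℕ} (hn : 4 ≤ n) : ((n + 3).choose 2 + 1 : ℝ) ≤ 4 * n ^ 2 := by
  have h1 : (4 : ℝ) ≤ n := by exact_mod_cast hn
  rw [cast_choose_two_add_three]
  nlinarith

lemma eventually_PrGnm_badCut_le (hmN : ∀ n, m n ≤ (n + 3).choose 2)
    (hmp : Tendsto (fun n : ℕ => (m n : ℝ) / ((n + 3).choose 2 : ℝ)) atTop (𝓝 p))
    {y : ℝ} (hy : 1 - p / 2 < y) (hy0 : 0 ≤ y) (hy1 : y < 1) (t : ℕ) :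
    ∀ᶠ n in atTop, PrGnm (n + 3) (m n) (badCut (n + 3) t) ≤
      8 * 4 ^ t * ((n : ℝ) ^ (t + 3) * y ^ (t * (n + 3 - t))) := by
  filter_upwards [eventually_ge_atTop 4, eventually_mul_pow_le_one hy0 hy1 (t := t),
    ((hmp.div_const 2).const_sub 1).eventually (gt_mem_nhds hy)] with n h4 hpow hq
  have hN0 : 0 < (n + 3).choose 2 := Nat.choose_pos (by omega)
  have hP0 : (0 : ℝ) ≤ m n / (n + 3).choose 2 := by positivity
  have hP1 : (m n / (n + 3).choose 2 : ℝ) ≤ 1 := by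
    rw [div_le_one (by exact_mod_cast hN0)]
    exact_mod_cast hmN n
  refine (PrGnm_le_mul_PrGnp (hmN n) hN0 _).trans ?_
  have hN := choose_two_add_one_le h4
  generalize (m n / (n + 3).choose 2 : ℝ) = P at *
  have hP2 : 0 ≤ 1 - P / 2 := by linarith
  have h := PrGnp_badCut_le (n := n + 3) (t := t) hP0 hP1 (by
    refine le_trans ?_ hpow
    push_cast
    gcongr)
  have hn : (4 : ℝ) ≤ n := by exact_mod_cast h4
  push_cast at h
  calc _ ≤ (4 * n ^ 2 : ℝ) * ((n + 3 + 1) * (2 * (n + 3)) ^ t *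
        (1 - P / 2) ^ (t * (n + 3 - t))) := by
        refine mul_le_mul hN h (prWeight_nonneg (gnpWeight_nonneg hP0 hP1) _) (by positivity)
    _ ≤ (4 * n ^ 2 : ℝ) * ((2 * n) * (4 * n) ^ t * y ^ (t * (n + 3 - t))) := by
        gcongr (4 * n ^ 2 : ℝ) * (?_ * ?_ ^ t * ?_ ^ _) <;> linarith
    _ = _ := by ring

lemma eventually_PrGnm_nearIsolated_le (hmN : ∀ n, m n ≤ (n + 3).choose 2)
    (hmp : Tendsto (fun n : ℕ => (m n : ℝ) / ((n + 3).choose 2 : ℝ)) atTop (𝓝 p))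
    {z : ℝ} (hz : 1 - p < z) :
    ∀ᶠ n in atTop, PrGnm (n + 3) (m n) (nearIsolated (n + 3)) ≤
      128 * ((n : ℝ) ^ 7 * z ^ (n - 1)) := by
  filter_upwards [eventually_ge_atTop 4, (hmp.const_sub 1).eventually (gt_mem_nhds hz)]
    with n h4 hq
  have hN0 : 0 < (n + 3).choose 2 := Nat.choose_pos (by omega)
  have hP0 : (0 : ℝ) ≤ m n / (n + 3).choose 2 := by positivity
  have hP1 : (m n / (n + 3).choose 2 : ℝ) ≤ 1 := by
    rw [div_le_one (by exact_mod_cast hN0)]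
    exact_mod_cast hmN n
  refine (PrGnm_le_mul_PrGnp (hmN n) hN0 _).trans ?_
  have hN := choose_two_add_one_le h4
  generalize (m n / (n + 3).choose 2 : ℝ) = P at *
  have hP2 : 0 ≤ 1 - P := by linarith
  have h := PrGnp_nearIsolated_le (n := n + 3) (by omega) hP0 hP1
  have hn : (4 : ℝ) ≤ n := by exact_mod_cast h4
  rw [show n + 3 - 4 = n - 1 by omega] at h
  push_cast at h
  calc _ ≤ (4 * n ^ 2 : ℝ) * ((n + 3) ^ 5 * (1 - P) ^ (n - 1)) :=
        mul_le_mul hN h (prWeight_nonneg (gnpWeight_nonneg hP0 hP1) _) (by positivity)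
    _ ≤ (4 * n ^ 2 : ℝ) * ((2 * n) ^ 5 * z ^ (n - 1)) := by
        gcongr
        linarith
    _ = _ := by ring

lemma tendsto_badCut_two_div (hp0 : 0 < p) (hp1 : p ≤ 1) (hm1 : ∀ᶠ n in atTop, 1 ≤ m n)
    (hmN : ∀ n, m n ≤ (n + 3).choose 2)
    (hmp : Tendsto (fun n : ℕ => (m n : ℝ) / ((n + 3).choose 2 : ℝ)) atTop (𝓝 p)) :
    Tendsto (fun n => PrGnm (n + 3) (m n) (badCut (n + 3) 2) /
      avoidProb ((n + 3).choose 2) (m n) (n + 2)) atTop (𝓝 0) := by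
  obtain ⟨x, y, z, hx0, hx, hy, hy1, hz, h2, h3, h4⟩ := exists_decay_rates hp0 hp1
  have hy0 : 0 < y := by linarith
  have hF := eventually_pow_le_avoidProb hm1 hmN hmp hx0.le hx
  have hB := eventually_PrGnm_badCut_le hmN hmp hy hy0.le hy1 2
  simp only [show ∀ n, n + 3 - 2 = n + 1 from fun _ => rfl] at hB
  refine tendsto_zero_of_le_pow_mul (C := 128 * (y ^ 2 / x ^ 2)) (x := y ^ 2 / x) (by positivity)
    (by rwa [div_lt_one hx0]) ?_ ?_
  · filter_upwards [hF] with n hF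
    exact div_nonneg (PrGnm_nonneg _ _ _) ((pow_nonneg hx0.le _).trans (hF _ (by omega)))
  · filter_upwards [hF, hB, eventually_ge_atTop 1] with n hF hB hn
    have hn : (1 : ℝ) ≤ n := by exact_mod_cast hn
    calc _ ≤ 8 * 4 ^ 2 * ((n : ℝ) ^ (2 + 3) * y ^ (2 * (n + 1))) / x ^ (n + 2) :=
          div_le_div₀ (by positivity) hB (by positivity) (hF _ (by omega))
      _ ≤ 8 * 4 ^ 2 * ((n : ℝ) ^ 7 * y ^ (2 * (n + 1))) / x ^ (n + 2) := by
          gcongr 8 * 4 ^ 2 * (?_ * _) / _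
          exact pow_le_pow_right₀ hn (by norm_num)
      _ = _ := by
          rw [div_pow, ← pow_mul]
          field_simp
          ring

lemma tendsto_badCut_three_div (hp0 : 0 < p) (hp1 : p ≤ 1) (hm1 : ∀ᶠ n in atTop, 1 ≤ m n)
    (hmN : ∀ n, m n ≤ (n + 3).choose 2)
    (hmp : Tendsto (fun n : ℕ => (m n : ℝ) / ((n + 3).choose 2 : ℝ)) atTop (𝓝 p)) :
    Tendsto (fun n => PrGnm (n + 3) (m n) (badCut (n + 3) 3) /
      avoidProb ((n + 3).choose 2) (m n) (2 * n + 3)) atTop (𝓝 0) := by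
  obtain ⟨x, y, z, hx0, hx, hy, hy1, hz, h2, h3, h4⟩ := exists_decay_rates hp0 hp1
  have hy0 : 0 < y := by linarith
  have hF := eventually_pow_le_avoidProb hm1 hmN hmp hx0.le hx
  have hB := eventually_PrGnm_badCut_le hmN hmp hy hy0.le hy1 3
  simp only [show ∀ n, n + 3 - 3 = n from fun _ => rfl] at hB
  refine tendsto_zero_of_le_pow_mul (C := 512 / x ^ 3) (x := y ^ 3 / x ^ 2) (by positivity)
    (by rwa [div_lt_one (by positivity)]) ?_ ?_
  · filter_upwards [hF] with n hF
    exact div_nonneg (PrGnm_nonneg _ _ _) ((pow_nonneg hx0.le _).trans (hF _ (by omega)))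
  · filter_upwards [hF, hB, eventually_ge_atTop 1] with n hF hB hn
    have hn : (1 : ℝ) ≤ n := by exact_mod_cast hn
    calc _ ≤ 8 * 4 ^ 3 * ((n : ℝ) ^ (3 + 3) * y ^ (3 * n)) / x ^ (2 * n + 3) :=
          div_le_div₀ (by positivity) hB (by positivity) (hF _ (by omega))
      _ ≤ 8 * 4 ^ 3 * ((n : ℝ) ^ 7 * y ^ (3 * n)) / x ^ (2 * n + 3) := by
          gcongr 8 * 4 ^ 3 * (?_ * _) / _
          exact pow_le_pow_right₀ hn (by norm_num)
      _ = _ := by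
          rw [div_pow, ← pow_mul, ← pow_mul]
          field_simp
          ring

lemma tendsto_nearIsolated_div (hp0 : 0 < p) (hp1 : p ≤ 1) (hm1 : ∀ᶠ n in atTop, 1 ≤ m n)
    (hmN : ∀ n, m n ≤ (n + 3).choose 2)
    (hmp : Tendsto (fun n : ℕ => (m n : ℝ) / ((n + 3).choose 2 : ℝ)) atTop (𝓝 p)) :
    Tendsto (fun n => PrGnm (n + 3) (m n) (nearIsolated (n + 3)) /
      avoidProb ((n + 3).choose 2) (m n) (2 * n + 3)) atTop (𝓝 0) := by
  obtain ⟨x, y, z, hx0, hx, hy, hy1, hz, h2, h3, h4⟩ := exists_decay_rates hp0 hp1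
  have hz0 : 0 < z := by linarith
  have hF := eventually_pow_le_avoidProb hm1 hmN hmp hx0.le hx
  have hB := eventually_PrGnm_nearIsolated_le hmN hmp hz
  refine tendsto_zero_of_le_pow_mul (C := 128 / (z * x ^ 3)) (x := z / x ^ 2) (by positivity)
    (by rwa [div_lt_one (by positivity)]) ?_ ?_
  · filter_upwards [hF] with n hF
    exact div_nonneg (PrGnm_nonneg _ _ _) ((pow_nonneg hx0.le _).trans (hF _ (by omega)))
  · filter_upwards [hF, hB, eventually_ge_atTop 1] with n hF hB hn
    calc _ ≤ 128 * ((n : ℝ) ^ 7 * z ^ (n - 1)) / x ^ (2 * n + 3) :=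
          div_le_div₀ (by positivity) hB (by positivity) (hF _ (by omega))
      _ = _ := by
          obtain ⟨n, rfl⟩ := Nat.exists_eq_add_of_le' hn
          rw [div_pow, ← pow_mul, Nat.add_sub_cancel]
          field_simp
          ring

lemma eventually_avoidProb_pos (hm1 : ∀ᶠ n in atTop, 1 ≤ m n)
    (hmN : ∀ n, m n ≤ (n + 3).choose 2) :
    ∀ᶠ n in atTop, ∀ k ≤ 2 * n + 3, 0 < avoidProb ((n + 3).choose 2) (m n) k := by
  filter_upwards [hm1, eventually_ge_atTop 3] with n h1 h3 k hk
  have hkN := lt_choose_two h3 hk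
  refine div_pos (oriCount_pos ?_) (oriCount_pos ?_) <;> have := hmN n <;> omega

lemma tendsto_PrGnm_not_reaches_div (hp0 : 0 < p) (hp1 : p ≤ 1) (hm1 : ∀ᶠ n in atTop, 1 ≤ m n)
    (hmN : ∀ n, m n ≤ (n + 3).choose 2)
    (hmp : Tendsto (fun n : ℕ => (m n : ℝ) / ((n + 3).choose 2 : ℝ)) atTop (𝓝 p))
    {s a : (n : ℕ) → Fin (n + 3)} (hsa : ∀ n, s n ≠ a n) :
    Tendsto (fun n => PrGnm (n + 3) (m n) {f | ¬ Reaches f (s n) (a n)} /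
      avoidProb ((n + 3).choose 2) (m n) (n + 2)) atTop (𝓝 2) := by
  refine tendsto_iff_norm_sub_tendsto_zero.2 (squeeze_zero' (.of_forall fun _ => norm_nonneg _) ?_
    (tendsto_badCut_two_div hp0 hp1 hm1 hmN hmp))
  filter_upwards [eventually_avoidProb_pos hm1 hmN, eventually_ge_atTop 1] with n hF hn
  have hF := hF (n + 2) (by omega)
  have h := abs_PrGnm_not_reaches_sub_le (by omega) (m n) (hsa n)
  rw [show n + 3 - 1 = n + 2 from rfl] at h
  rw [norm_eq_abs, div_sub' hF.ne', abs_div, abs_of_pos hF, mul_comm _ (2 : ℝ)]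
  gcongr

lemma tendsto_PrGnm_joint_div (hp0 : 0 < p) (hp1 : p ≤ 1) (hm1 : ∀ᶠ n in atTop, 1 ≤ m n)
    (hmN : ∀ n, m n ≤ (n + 3).choose 2)
    (hmp : Tendsto (fun n : ℕ => (m n : ℝ) / ((n + 3).choose 2 : ℝ)) atTop (𝓝 p))
    {s a b : (n : ℕ) → Fin (n + 3)} (hsa : ∀ n, s n ≠ a n) (hsb : ∀ n, s n ≠ b n)
    (hab : ∀ n, a n ≠ b n) :
    Tendsto (fun n =>
      PrGnm (n + 3) (m n) {f | ¬ Reaches f (s n) (a n) ∧ ¬ Reaches f (b n) (s n)} /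
        avoidProb ((n + 3).choose 2) (m n) (2 * n + 3)) atTop (𝓝 3) := by
  have herr := ((tendsto_badCut_three_div hp0 hp1 hm1 hmN hmp).const_mul 2).add
    (tendsto_nearIsolated_div hp0 hp1 hm1 hmN hmp)
  rw [mul_zero, add_zero] at herr
  refine tendsto_iff_norm_sub_tendsto_zero.2 (squeeze_zero' (.of_forall fun _ => norm_nonneg _) ?_
    herr)
  filter_upwards [eventually_avoidProb_pos hm1 hmN, eventually_ge_atTop 5] with n hF hn
  have hF := hF (2 * n + 3) le_rfl
  have h := abs_PrGnm_joint_sub_le (by omega) (m n) (hsa n) (hsb n) (hab n)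
  rw [show 2 * (n + 3 - 2) + 1 = 2 * n + 3 by omega] at h
  rw [norm_eq_abs, div_sub' hF.ne', abs_div, abs_of_pos hF, mul_comm _ (3 : ℝ),
    ← mul_div_assoc, ← add_div]
  gcongr

lemma tendsto_covariance_div (hp0 : 0 < p) (hp1 : p ≤ 1) (hm1 : ∀ᶠ n in atTop, 1 ≤ m n)
    (hmN : ∀ n, m n ≤ (n + 3).choose 2)
    (hmp : Tendsto (fun n : ℕ => (m n : ℝ) / ((n + 3).choose 2 : ℝ)) atTop (𝓝 p))
    {s a b : (n : ℕ) → Fin (n + 3)} (hsa : ∀ n, s n ≠ a n) (hsb : ∀ n, s n ≠ b n)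
    (hab : ∀ n, a n ≠ b n) :
    Tendsto (fun n =>
      (PrGnm (n + 3) (m n) {f | ¬ Reaches f (s n) (a n) ∧ ¬ Reaches f (b n) (s n)} -
        PrGnm (n + 3) (m n) {f | ¬ Reaches f (s n) (a n)} *
          PrGnm (n + 3) (m n) {f | ¬ Reaches f (b n) (s n)}) /
        avoidProb ((n + 3).choose 2) (m n) (n + 2) ^ 2) atTop
      (𝓝 ((3 * exp (-(2 * p * (1 - p)) / (2 - p) ^ 2) - (4 - 2 * p)) / (1 - p / 2))) := by
  have h := ((tendsto_PrGnm_joint_div hp0 hp1 hm1 hmN hmp hsa hsb hab).mul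
    (tendsto_avoidProb_div_sq hp1 hm1 hmN hmp)).sub
    ((tendsto_PrGnm_not_reaches_div hp0 hp1 hm1 hmN hmp hsa).mul
      (tendsto_PrGnm_not_reaches_div hp0 hp1 hm1 hmN hmp fun n => (hsb n).symm))
  have e : (3 * exp (-(2 * p * (1 - p)) / (2 - p) ^ 2) - (4 - 2 * p)) / (1 - p / 2) =
      3 * (exp (-(2 * p * (1 - p)) / (2 - p) ^ 2) / (1 - p / 2)) - 2 * 2 := by
    have : 1 - p / 2 ≠ 0 := by linarith
    rw [sub_div, mul_div_assoc, show 4 - 2 * p = 2 * 2 * (1 - p / 2) by ring,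
      mul_div_cancel_right₀ _ this]
  rw [e]
  refine h.congr' ?_
  filter_upwards [eventually_avoidProb_pos hm1 hmN] with n hF
  have h1 := hF (n + 2) (by omega)
  have h2 := hF (2 * n + 3) le_rfl
  field_simp

end Errors

section Threshold

lemma strictMonoOn_log_add_quadratic :
    StrictMonoOn (fun w : ℝ => 4 * w ^ 2 - 6 * w + log w) (Set.Icc (1 / 2) 1) := by
  have hne : ∀ w ∈ Set.Icc (1 / 2 : ℝ) 1, w ≠ 0 := fun w hw => by linarith [hw.1]
  refine strictMonoOn_of_deriv_pos (convex_Icc _ _) ?_ fun w hw => ?_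
  · exact ContinuousOn.add (by fun_prop) (continuousOn_log.mono hne)
  · rw [interior_Icc] at hw
    have hw0 : 0 < w := by linarith [hw.1]
    have hd : HasDerivAt (fun w : ℝ => 4 * w ^ 2 - 6 * w + log w)
        (4 * (2 * w) - 6 * 1 + w⁻¹) w := by
      have h1 : HasDerivAt (fun w : ℝ => w ^ 2) (2 * w) w := by simpa using hasDerivAt_pow 2 w
      exact ((h1.const_mul 4).sub ((hasDerivAt_id w).const_mul 6)).add (hasDerivAt_log hw0.ne')
    rw [hd.deriv, show 4 * (2 * w) - 6 * 1 + w⁻¹ = (4 * w - 1) * (2 * w - 1) / w by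
      field_simp; ring]
    have := hw.1
    exact div_pos (mul_pos (by linarith) (by linarith)) hw0

lemma exp_mul_inv_lt {x y : ℝ} (hx : 0 ≤ x) (hxy : x < y) (hy : y ≤ 1) :
    exp (-(2 * x * (1 - x)) / (2 - x) ^ 2) * (2 - x)⁻¹ <
      exp (-(2 * y * (1 - y)) / (2 - y) ^ 2) * (2 - y)⁻¹ := by
  have key : ∀ z ≤ (1 : ℝ), exp (-(2 * z * (1 - z)) / (2 - z) ^ 2) * (2 - z)⁻¹ =
      exp (2 + (4 * (2 - z)⁻¹ ^ 2 - 6 * (2 - z)⁻¹ + log (2 - z)⁻¹)) := fun z hz => by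
    have h : 0 < 2 - z := by linarith
    rw [← add_assoc, exp_add _ (log _), exp_log (by positivity)]
    congr 2
    field_simp
    ring
  have hmem : ∀ z, 0 ≤ z → z ≤ 1 → (2 - z)⁻¹ ∈ Set.Icc (1 / 2 : ℝ) 1 := fun z h0 h1 => by
    rw [one_div]
    exact ⟨inv_anti₀ (by linarith) (by linarith), inv_le_one_of_one_le₀ (by linarith)⟩
  rw [key x (by linarith), key y hy, exp_lt_exp]
  gcongr 2 + ?_
  exact strictMonoOn_log_add_quadratic (hmem x hx (by linarith)) (hmem y (by linarith) hy)
    (inv_strictAnti₀ (by linarith) (by linarith))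

end Threshold

/-- Suppose `m = m(n) → ∞` with `m(n)/C(n,2) → p ∈ (0,1]`, and let
`p_c` be the (unique) root in `[0,1]` of `3 exp(-2p(1-p)/(2-p)^2) = 4 - 2p`.
For distinct vertices `s, a, b` of `⃗G(n,m)` (graphs on `n + 3` vertices):
if `p < p_c` then `Cov({s ↛ a}, {b ↛ s}) < 0` for all large `n`, and if `p_c < p`
then the covariance is positive for all large `n`. -/
theorem gnm_covariance_sign
    (m : ℕ → ℕ) (hmN : ∀ n, m n ≤ Nat.choose (n + 3) 2)
    (hm : Filter.Tendsto m Filter.atTop Filter.atTop)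
    (p : ℝ) (hp : p ∈ Set.Ioc (0 : ℝ) 1)
    (hmp : Filter.Tendsto (fun n : ℕ => (m n : ℝ) / (Nat.choose (n + 3) 2 : ℝ))
      Filter.atTop (nhds p))
    (pc : ℝ) (hpc : pc ∈ Set.Icc (0 : ℝ) 1)
    (hpcroot : 3 * Real.exp (-(2 * pc * (1 - pc)) / (2 - pc) ^ 2) = 4 - 2 * pc)
    (s a b : (n : ℕ) → Fin (n + 3))
    (hsa : ∀ n, s n ≠ a n) (hsb : ∀ n, s n ≠ b n) (hab : ∀ n, a n ≠ b n) :
    (p < pc →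
      ∀ᶠ n : ℕ in Filter.atTop,
        PrGnm (n + 3) (m n) {f | ¬ Reaches f (s n) (a n) ∧ ¬ Reaches f (b n) (s n)} -
            PrGnm (n + 3) (m n) {f | ¬ Reaches f (s n) (a n)} *
              PrGnm (n + 3) (m n) {f | ¬ Reaches f (b n) (s n)} < 0) ∧
    (pc < p →
      ∀ᶠ n : ℕ in Filter.atTop,
        0 < PrGnm (n + 3) (m n) {f | ¬ Reaches f (s n) (a n) ∧ ¬ Reaches f (b n) (s n)} -
            PrGnm (n + 3) (m n) {f | ¬ Reaches f (s n) (a n)} *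
              PrGnm (n + 3) (m n) {f | ¬ Reaches f (b n) (s n)}) := by
  have hm1 : ∀ᶠ n in atTop, 1 ≤ m n := hm.eventually_ge_atTop 1
  have hlim := tendsto_covariance_div hp.1 hp.2 hm1 hmN hmp hsa hsb hab
  have hq : 0 < 1 - p / 2 := by linarith [hp.2]
  have hp2 : 0 < 2 - p := by linarith [hp.2]
  have hpc2 : 0 < 2 - pc := by linarith [hpc.2]
  have hF := eventually_avoidProb_pos hm1 hmN
  have hroot : 3 * (exp (-(2 * pc * (1 - pc)) / (2 - pc) ^ 2) * (2 - pc)⁻¹) = 2 := by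
    rw [← mul_assoc, hpcroot]
    field_simp
    ring
  have hval : 3 * (exp (-(2 * p * (1 - p)) / (2 - p) ^ 2) * (2 - p)⁻¹) * (2 - p) =
      3 * exp (-(2 * p * (1 - p)) / (2 - p) ^ 2) := by
    field_simp
  refine ⟨fun h => ?_, fun h => ?_⟩
  · have hlt := exp_mul_inv_lt hp.1.le h hpc.2
    have hneg : (3 * exp (-(2 * p * (1 - p)) / (2 - p) ^ 2) - (4 - 2 * p)) / (1 - p / 2) < 0 :=
      div_neg_of_neg_of_pos (by nlinarith) hq
    filter_upwards [hlim.eventually (gt_mem_nhds hneg), hF] with n hn hF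
    exact neg_of_div_neg_left hn (pow_pos (hF _ (by omega)) 2).le
  · have hlt := exp_mul_inv_lt hpc.1 h hp.2
    have hpos : 0 < (3 * exp (-(2 * p * (1 - p)) / (2 - p) ^ 2) - (4 - 2 * p)) / (1 - p / 2) :=
      div_pos (by nlinarith) hq
    filter_upwards [hlim.eventually (lt_mem_nhds hpos), hF] with n hn hF
    exact (div_pos_iff_of_pos_right (pow_pos (hF _ (by omega)) 2)).1 hn
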